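/- arXiv:2104.00577 — 2 statements merged into one kernel-verified Lean document; each statement's English description precedes it below -/
import Mathlib

section
/- Let G be a unicyclic graph and set m = max{0, 2−b(G)}. Then L(G)+m ≤ dim(G) ≤ L(G)+m+1 and L(G)+m ≤ edim(G) ≤ L(G)+m+1; in particular |dim(G) − edim(G)| ≤ 1. -/
open SimpleGraph

section Defs

variable {V : Type*}

/-- Distance from a vertex `s` to an edge `e`: the minimum of the distances to its endpoints. -/
noncomputable def edgeDist (G : SimpleGraph V) (s : V) (e : Sym2 V) : ℕ :=
  Sym2.lift ⟨fun u w => min (G.dist s u) (G.dist s w), fun u w => min_comm _ _⟩ e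

/-- `S` is a vertex metric generator of `G`. -/
def IsVertexMG (G : SimpleGraph V) (S : Set V) : Prop :=
  ∀ u v : V, u ≠ v → ∃ s ∈ S, G.dist s u ≠ G.dist s v

/-- `S` is an edge metric generator of `G`. -/
def IsEdgeMG (G : SimpleGraph V) (S : Set V) : Prop :=
  ∀ e ∈ G.edgeSet, ∀ f ∈ G.edgeSet, e ≠ f → ∃ s ∈ S, edgeDist G s e ≠ edgeDist G s f

/-- The vertex metric dimension of `G`. -/
noncomputable def metricDim (G : SimpleGraph V) : ℕ :=
  sInf {n | ∃ S : Finset V, S.card = n ∧ IsVertexMG G ↑S}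

/-- The edge metric dimension of `G`. -/
noncomputable def edgeMetricDim (G : SimpleGraph V) : ℕ :=
  sInf {n | ∃ S : Finset V, S.card = n ∧ IsEdgeMG G ↑S}

/-- `G` is unicyclic: connected, contains a cycle, and any two cycles have the same edges. -/
def IsUnicyclic (G : SimpleGraph V) : Prop :=
  G.Connected ∧ (∃ (u : V) (w : G.Walk u u), w.IsCycle) ∧
    ∀ (u u' : V) (w : G.Walk u u) (w' : G.Walk u' u'), w.IsCycle → w'.IsCycle →
      ∀ e, e ∈ w.edges ↔ e ∈ w'.edges

/-- `vc : ZMod g → V` is a labelling `v_0 v_1 ⋯ v_{g-1}` of a cycle of length `g` in `G`. -/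
def IsCycleLabelling (G : SimpleGraph V) (g : ℕ) (vc : ZMod g → V) : Prop :=
  Function.Injective vc ∧ ∀ i : ZMod g, G.Adj (vc i) (vc (i + 1))

/-- The set of edges of the cycle `C`. -/
def cycleEdges (g : ℕ) (vc : ZMod g → V) : Set (Sym2 V) :=
  {e | ∃ i : ZMod g, e = s(vc i, vc (i + 1))}

/-- The graph `G - E(C)`. -/
def offCycle (G : SimpleGraph V) (g : ℕ) (vc : ZMod g → V) : SimpleGraph V :=
  G.deleteEdges (cycleEdges g vc)

/-- `x` belongs to `T_{v_i}`, the connected component of `G - E(C)` containing `v_i`. -/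
def inTree (G : SimpleGraph V) (g : ℕ) (vc : ZMod g → V) (i : ZMod g) (x : V) : Prop :=
  (offCycle G g vc).Reachable (vc i) x

/-- The vertex `v_i` of the cycle is `S`-active: `T_{v_i}` contains a vertex of `S`. -/
def SActive (G : SimpleGraph V) (g : ℕ) (vc : ZMod g → V) (S : Set V) (i : ZMod g) : Prop :=
  ∃ s ∈ S, inTree G g vc i s

/-- `a_S(C)`: the number of `S`-active vertices on the cycle. -/
noncomputable def aS (G : SimpleGraph V) (g : ℕ) (vc : ZMod g → V) (S : Set V) : ℕ :=
  {i : ZMod g | SActive G g vc S i}.ncard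

/-- `S` is biactive: `a_S(C) ≥ 2`. -/
def Biactive (G : SimpleGraph V) (g : ℕ) (vc : ZMod g → V) (S : Set V) : Prop :=
  2 ≤ aS G g vc S

variable [Fintype V] [DecidableEq V]

/-- `t = u_1 u_2 ⋯ u_k` is a thread hanging at the vertex `v`. -/
def IsThreadAt (G : SimpleGraph V) [DecidableRel G.Adj] (v : V) (t : List V) : Prop :=
  t ≠ [] ∧ t.Nodup ∧ v ∉ t ∧ 3 ≤ G.degree v ∧ List.Chain' G.Adj t ∧
    (∀ u ∈ t.head?, G.Adj v u) ∧ (∀ u ∈ t.getLast?, G.degree u = 1) ∧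
    ∀ u ∈ t.dropLast, G.degree u = 2

/-- The thread `t` is `S`-free: it contains no vertex of `S`. -/
def SFree (S : Set V) (t : List V) : Prop := ∀ u ∈ t, u ∉ S

/-- `S` is branch-resolving: for every vertex, all threads hanging at it except possibly
one contain a vertex of `S` (i.e. at most one thread at each vertex is `S`-free). -/
def BranchResolving (G : SimpleGraph V) [DecidableRel G.Adj] (S : Set V) : Prop :=
  ∀ v : V, ∀ t₁ t₂ : List V, IsThreadAt G v t₁ → IsThreadAt G v t₂ → t₁ ≠ t₂ →
    (∃ s ∈ S, s ∈ t₁) ∨ (∃ s ∈ S, s ∈ t₂)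

/-- `ℓ(v)`: the number of threads hanging at `v`. -/
noncomputable def numThreads (G : SimpleGraph V) [DecidableRel G.Adj] (v : V) : ℕ :=
  {t : List V | IsThreadAt G v t}.ncard

/-- `L(G) = Σ (ℓ(v) - 1)` (truncated subtraction makes the sum run exactly over the
vertices with `ℓ(v) > 1`). -/
noncomputable def LG (G : SimpleGraph V) [DecidableRel G.Adj] : ℕ :=
  ∑ v : V, (numThreads G v - 1)

/-- `x` is a branching vertex of the unicyclic graph with cycle `vc`. -/
def Branching (G : SimpleGraph V) [DecidableRel G.Adj] (g : ℕ) (vc : ZMod g → V) (x : V) :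
    Prop :=
  (x ∉ Set.range vc ∧ 3 ≤ G.degree x) ∨ (x ∈ Set.range vc ∧ 4 ≤ G.degree x)

/-- The cycle vertex `v_i` is branch-active: `T_{v_i}` contains a branching vertex. -/
def BranchActive (G : SimpleGraph V) [DecidableRel G.Adj] (g : ℕ) (vc : ZMod g → V)
    (i : ZMod g) : Prop :=
  ∃ x, inTree G g vc i x ∧ Branching G g vc x

/-- `b(G)`: the number of branch-active vertices on the cycle. -/
noncomputable def bG (G : SimpleGraph V) [DecidableRel G.Adj] (g : ℕ) (vc : ZMod g → V) : ℕ :=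
  {i : ZMod g | BranchActive G g vc i}.ncard

/-- `k = max { i : v_i is S-active }` for the labelling `vc` (indices taken in `[0, g-1]`). -/
noncomputable def kOf (G : SimpleGraph V) (g : ℕ) (vc : ZMod g → V) (S : Set V) : ℕ :=
  sSup {n : ℕ | n < g ∧ SActive G g vc S (n : ZMod g)}

/-- The labelling `vc` of the cycle is canonical with respect to `S`: `v_0` is `S`-active
and `k` is as small as possible among all labellings of the cycle with `v_0` `S`-active. -/
def Canonical (G : SimpleGraph V) (g : ℕ) (vc : ZMod g → V) (S : Set V) : Prop :=
  IsCycleLabelling G g vc ∧ SActive G g vc S 0 ∧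
    ∀ vc' : ZMod g → V, IsCycleLabelling G g vc' → Set.range vc' = Set.range vc →
      SActive G g vc' S 0 → kOf G g vc S ≤ kOf G g vc' S

/-- Configuration 𝒜 : `a_S(C) = 2`, `g` even and `k = g/2`. -/
def ConfigA (G : SimpleGraph V) (g : ℕ) (vc : ZMod g → V) (S : Set V) : Prop :=
  aS G g vc S = 2 ∧ Even g ∧ kOf G g vc S = g / 2

/-- Configuration ℬ : `k ≤ ⌊g/2⌋ - 1` and an `S`-free thread hangs at `v_i` for some
`i ∈ [k, ⌊g/2⌋-1] ∪ [⌈g/2⌉+k+1, g-1] ∪ {0}`. -/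
def ConfigB (G : SimpleGraph V) [DecidableRel G.Adj] (g : ℕ) (vc : ZMod g → V) (S : Set V) :
    Prop :=
  kOf G g vc S ≤ g / 2 - 1 ∧
    ∃ i : ℕ, ((kOf G g vc S ≤ i ∧ i ≤ g / 2 - 1) ∨
        ((g + 1) / 2 + kOf G g vc S + 1 ≤ i ∧ i ≤ g - 1) ∨ i = 0) ∧
      ∃ t : List V, IsThreadAt G (vc (i : ZMod g)) t ∧ SFree S t

/-- Configuration 𝒞 : `a_S(C) = 2`, `g` even, `k ≤ g/2` and an `S`-free thread of length
`≥ g/2 - k` hangs at `v_i` for some `i ∈ [0, k]`. -/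
def ConfigC (G : SimpleGraph V) [DecidableRel G.Adj] (g : ℕ) (vc : ZMod g → V) (S : Set V) :
    Prop :=
  aS G g vc S = 2 ∧ Even g ∧ kOf G g vc S ≤ g / 2 ∧
    ∃ i : ℕ, i ≤ kOf G g vc S ∧
      ∃ t : List V, IsThreadAt G (vc (i : ZMod g)) t ∧ SFree S t ∧
        g / 2 - kOf G g vc S ≤ t.length

/-- Configuration 𝒟 : `k ≤ ⌈g/2⌉ - 1` and an `S`-free thread hangs at `v_i` for some
`i ∈ [k, ⌈g/2⌉-1] ∪ [⌊g/2⌋+k+1, g-1] ∪ {0}`. -/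
def ConfigD (G : SimpleGraph V) [DecidableRel G.Adj] (g : ℕ) (vc : ZMod g → V) (S : Set V) :
    Prop :=
  kOf G g vc S ≤ (g + 1) / 2 - 1 ∧
    ∃ i : ℕ, ((kOf G g vc S ≤ i ∧ i ≤ (g + 1) / 2 - 1) ∨
        (g / 2 + kOf G g vc S + 1 ≤ i ∧ i ≤ g - 1) ∨ i = 0) ∧
      ∃ t : List V, IsThreadAt G (vc (i : ZMod g)) t ∧ SFree S t

/-- Configuration ℰ : `a_S(C) = 2` and an `S`-free thread of length `≥ ⌊g/2⌋ - k + 1`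
hangs at `v_i` with `i ∈ [0, k]`; moreover if `g` is even an `S`-free thread hangs at
`v_j` with `j = g/2 + k - i`. -/
def ConfigE (G : SimpleGraph V) [DecidableRel G.Adj] (g : ℕ) (vc : ZMod g → V) (S : Set V) :
    Prop :=
  aS G g vc S = 2 ∧
    ∃ i : ℕ, i ≤ kOf G g vc S ∧
      (∃ t : List V, IsThreadAt G (vc (i : ZMod g)) t ∧ SFree S t ∧
        g / 2 - kOf G g vc S + 1 ≤ t.length) ∧
      (Even g → ∃ t' : List V,
        IsThreadAt G (vc ((g / 2 + kOf G g vc S - i : ℕ) : ZMod g)) t' ∧ SFree S t')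

/-- `G` contains configuration 𝒜 with respect to `S` (evaluated on a canonical labelling
of the cycle given by `vc`). -/
def ContainsA (G : SimpleGraph V) (g : ℕ) (vc : ZMod g → V) (S : Set V) : Prop :=
  ∃ vc' : ZMod g → V, IsCycleLabelling G g vc' ∧ Set.range vc' = Set.range vc ∧
    Canonical G g vc' S ∧ ConfigA G g vc' S

/-- `G` contains configuration ℬ with respect to `S`. -/
def ContainsB (G : SimpleGraph V) [DecidableRel G.Adj] (g : ℕ) (vc : ZMod g → V)
    (S : Set V) : Prop :=
  ∃ vc' : ZMod g → V, IsCycleLabelling G g vc' ∧ Set.range vc' = Set.range vc ∧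
    Canonical G g vc' S ∧ ConfigB G g vc' S

/-- `G` contains configuration 𝒞 with respect to `S`. -/
def ContainsC (G : SimpleGraph V) [DecidableRel G.Adj] (g : ℕ) (vc : ZMod g → V)
    (S : Set V) : Prop :=
  ∃ vc' : ZMod g → V, IsCycleLabelling G g vc' ∧ Set.range vc' = Set.range vc ∧
    Canonical G g vc' S ∧ ConfigC G g vc' S

/-- `G` contains configuration 𝒟 with respect to `S`. -/
def ContainsD (G : SimpleGraph V) [DecidableRel G.Adj] (g : ℕ) (vc : ZMod g → V)
    (S : Set V) : Prop :=
  ∃ vc' : ZMod g → V, IsCycleLabelling G g vc' ∧ Set.range vc' = Set.range vc ∧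
    Canonical G g vc' S ∧ ConfigD G g vc' S

/-- `G` contains configuration ℰ with respect to `S`. -/
def ContainsE (G : SimpleGraph V) [DecidableRel G.Adj] (g : ℕ) (vc : ZMod g → V)
    (S : Set V) : Prop :=
  ∃ vc' : ZMod g → V, IsCycleLabelling G g vc' ∧ Set.range vc' = Set.range vc ∧
    Canonical G g vc' S ∧ ConfigE G g vc' S

/-- `G` contains one of the configurations 𝒜, ℬ, 𝒞 with respect to `S`. -/
def ContainsABC (G : SimpleGraph V) [DecidableRel G.Adj] (g : ℕ) (vc : ZMod g → V)
    (S : Set V) : Prop :=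
  ContainsA G g vc S ∨ ContainsB G g vc S ∨ ContainsC G g vc S

/-- `G` contains one of the configurations 𝒜, 𝒟, ℰ with respect to `S`. -/
def ContainsADE (G : SimpleGraph V) [DecidableRel G.Adj] (g : ℕ) (vc : ZMod g → V)
    (S : Set V) : Prop :=
  ContainsA G g vc S ∨ ContainsD G g vc S ∨ ContainsE G g vc S

/-- `S` is a smallest branch-resolving set of `G`. -/
def SmallestBR (G : SimpleGraph V) [DecidableRel G.Adj] (S : Finset V) : Prop :=
  BranchResolving G ↑S ∧ ∀ S' : Finset V, BranchResolving G ↑S' → S.card ≤ S'.card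

/-- `S` is a smallest biactive branch-resolving set of `G`. -/
def SmallestBBR (G : SimpleGraph V) [DecidableRel G.Adj] (g : ℕ) (vc : ZMod g → V)
    (S : Finset V) : Prop :=
  BranchResolving G ↑S ∧ Biactive G g vc ↑S ∧
    ∀ S' : Finset V, BranchResolving G ↑S' → Biactive G g vc ↑S' → S.card ≤ S'.card

/-- `G` is 𝒜ℬ𝒞-negative. -/
def ABCneg (G : SimpleGraph V) [DecidableRel G.Adj] (g : ℕ) (vc : ZMod g → V) : Prop :=
  ∃ S : Finset V, SmallestBBR G g vc S ∧ ¬ ContainsABC G g vc ↑S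

/-- `G` is 𝒜𝒟ℰ-negative. -/
def ADEneg (G : SimpleGraph V) [DecidableRel G.Adj] (g : ℕ) (vc : ZMod g → V) : Prop :=
  ∃ S : Finset V, SmallestBBR G g vc S ∧ ¬ ContainsADE G g vc ↑S

end Defs

/-! ### Rooting a unicyclic graph at its cycle -/

section Rooting

variable {V : Type*} {G : SimpleGraph V} {g : ℕ} {vc : ZMod g → V}

theorem val_add_one_cases (hg : 3 ≤ g) (i : ZMod g) :
    (i.val + 1 < g ∧ (i + 1).val = i.val + 1) ∨ (i.val + 1 = g ∧ (i + 1).val = 0) := by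
  have : NeZero g := ⟨by omega⟩
  have : Fact (1 < g) := ⟨by omega⟩
  have h1 := ZMod.val_lt i
  rcases Nat.lt_or_ge (i.val + 1) g with h | h
  · left
    refine ⟨h, ?_⟩
    rw [ZMod.val_add, ZMod.val_one, Nat.mod_eq_of_lt h]
  · right
    have : i.val + 1 = g := by omega
    refine ⟨this, ?_⟩
    rw [ZMod.val_add, ZMod.val_one, this, Nat.mod_self]

/-- Every labelled cycle yields a graph cycle running through labelled edges only. -/
theorem exists_isCycle_edges_subset (hg : 3 ≤ g) (hvc : IsCycleLabelling G g vc) :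
    ∃ (u : V) (w : G.Walk u u), w.IsCycle ∧ ∀ e ∈ w.edges, e ∈ cycleEdges g vc := by
  have : NeZero g := ⟨by omega⟩
  have : Fact (1 < g) := ⟨by omega⟩
  set H : SimpleGraph V := SimpleGraph.fromEdgeSet (cycleEdges g vc) with hH
  have hadj : ∀ i, H.Adj (vc i) (vc (i + 1)) := fun i => by
    rw [hH, SimpleGraph.fromEdgeSet_adj]
    exact ⟨⟨i, rfl⟩, (hvc.2 i).ne⟩
  have hle : H ≤ G := by
    intro a b hab
    rw [hH, SimpleGraph.fromEdgeSet_adj] at hab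
    obtain ⟨⟨i, hi⟩, -⟩ := hab
    rcases Sym2.eq_iff.1 hi with ⟨rfl, rfl⟩ | ⟨rfl, rfl⟩
    · exact hvc.2 i
    · exact (hvc.2 i).symm
  have hreach : ∀ n : ℕ, n + 1 ≤ g →
      (H.deleteEdges {s(vc 0, vc 1)}).Reachable (vc 1) (vc ((n + 1 : ℕ) : ZMod g)) := by
    intro n
    induction n with
    | zero => intro _; simp
    | succ n ih =>
      intro hn
      refine (ih (by omega)).trans (SimpleGraph.Adj.reachable ?_)
      rw [SimpleGraph.deleteEdges_adj]
      have hc : (((n + 1 + 1 : ℕ)) : ZMod g) = ((n + 1 : ℕ) : ZMod g) + 1 := by push_cast; ring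
      refine ⟨by rw [hc]; exact hadj _, ?_⟩
      simp only [Set.mem_singleton_iff, Sym2.eq_iff, not_or, not_and]
      have hv : (((n + 1 : ℕ)) : ZMod g).val = n + 1 := ZMod.val_cast_of_lt (by omega)
      constructor
      · intro h
        have := congrArg ZMod.val (hvc.1 h)
        rw [hv, ZMod.val_zero] at this
        omega
      · intro h h'
        have h1 := congrArg ZMod.val (hvc.1 h)
        rw [hv, ZMod.val_one] at h1
        have h2 := congrArg ZMod.val (hvc.1 h')
        rw [hc, ZMod.val_zero] at h2
        rcases val_add_one_cases hg ((n + 1 : ℕ) : ZMod g) with h3 | h3 <;> omega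
  have h0 := hreach (g - 1) (by omega)
  rw [Nat.sub_add_cancel (by omega), ZMod.natCast_self] at h0
  have h01 := hadj 0
  rw [zero_add] at h01
  obtain ⟨u, w, hw, -⟩ :=
    SimpleGraph.adj_and_reachable_delete_edges_iff_exists_cycle.1 ⟨h01, h0.symm⟩
  refine ⟨u, w.mapLe hle, hw.mapLe hle, fun e he => ?_⟩
  rw [SimpleGraph.Walk.edges_mapLe_eq_edges] at he
  have := w.edges_subset_edgeSet he
  rw [hH, SimpleGraph.edgeSet_fromEdgeSet] at this
  exact this.1

/-- In a unicyclic graph every edge outside the cycle separates its endpoints. -/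
theorem not_reachable_of_notMem_cycleEdges (hG : IsUnicyclic G) (hg : 3 ≤ g)
    (hvc : IsCycleLabelling G g vc) {a b : V} (hab : G.Adj a b)
    (he : s(a, b) ∉ cycleEdges g vc) : ¬ (G.deleteEdges {s(a, b)}).Reachable a b := by
  intro hr
  obtain ⟨u, w, hw, hmem⟩ :=
    SimpleGraph.adj_and_reachable_delete_edges_iff_exists_cycle.1 ⟨hab, hr⟩
  obtain ⟨u', w', hw', hsub⟩ := exists_isCycle_edges_subset hg hvc
  exact he (hsub _ ((hG.2.2 _ _ w w' hw hw' _).1 hmem))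

/-- A rooting of `G` at the cycle `vc`: `par` sends a vertex outside the cycle to its parent,
`h` is the distance to the cycle and `ix` is the index of the tree containing a vertex. -/
structure CycleRooting (G : SimpleGraph V) (g : ℕ) (vc : ZMod g → V) (par : V → V) (h : V → ℕ)
    (ix : V → ZMod g) : Prop where
  labelling : IsCycleLabelling G g vc
  conn : G.Connected
  h_vc : ∀ i, h (vc i) = 0
  ix_vc : ∀ i, ix (vc i) = i
  vc_ix : ∀ x, h x = 0 → vc (ix x) = x
  par_zero : ∀ x, h x = 0 → par x = x
  adj_par : ∀ x, 0 < h x → G.Adj x (par x)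
  h_par : ∀ x, 0 < h x → h (par x) + 1 = h x
  ix_par : ∀ x, ix (par x) = ix x
  adj_cases : ∀ x y, G.Adj x y → (0 < h x ∧ par x = y) ∨ (0 < h y ∧ par y = x) ∨
    (h x = 0 ∧ h y = 0 ∧ (ix y = ix x + 1 ∨ ix x = ix y + 1))

theorem exists_cycleRooting (hG : IsUnicyclic G) (hg : 3 ≤ g) (hvc : IsCycleLabelling G g vc) :
    ∃ par h ix, CycleRooting G g vc par h ix := by
  classical
  have : NeZero g := ⟨by omega⟩
  have hconn := hG.1
  obtain ⟨h, hle, hex⟩ : ∃ h : V → ℕ, (∀ x i, h x ≤ G.dist x (vc i)) ∧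
      ∀ x, ∃ i, G.dist x (vc i) = h x :=
    ⟨fun x => sInf (Set.range fun i => G.dist x (vc i)), fun x i => Nat.sInf_le ⟨i, rfl⟩,
      fun x => Nat.sInf_mem (Set.range_nonempty _)⟩
  have h_vc : ∀ i, h (vc i) = 0 := fun i => by
    have := hle (vc i) i
    rw [SimpleGraph.dist_self] at this
    omega
  have h_zero : ∀ x, h x = 0 → ∃ i, vc i = x := fun x hx => by
    obtain ⟨i, hi⟩ := hex x
    rw [hx, hconn.dist_eq_zero_iff] at hi
    exact ⟨i, hi.symm⟩
  have h_low : ∀ x, 0 < h x → ∃ y, G.Adj x y ∧ h y + 1 = h x := by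
    intro x hx
    obtain ⟨i, hi⟩ := hex x
    obtain ⟨w, hw⟩ := hconn.exists_walk_length_eq_dist x (vc i)
    cases w with
    | nil => rw [h_vc] at hx; omega
    | @cons _ y _ hxy p =>
      refine ⟨y, hxy, ?_⟩
      have h1 := SimpleGraph.dist_le p
      have h2 := hle y i
      obtain ⟨j, hj⟩ := hex y
      have h3 := hle x j
      have h4 := hconn.dist_triangle (u := x) (v := y) (w := vc j)
      rw [SimpleGraph.dist_eq_one_iff_adj.2 hxy] at h4
      simp only [SimpleGraph.Walk.length_cons] at hw
      omega
  -- connection to the cycle below a given level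
  have hcyc : ∀ e : Sym2 V, e ∉ cycleEdges g vc → ∀ i,
      (G.deleteEdges {e}).Reachable (vc 0) (vc i) := by
    intro e he
    have : ∀ n : ℕ, (G.deleteEdges {e}).Reachable (vc 0) (vc (n : ZMod g)) := by
      intro n
      induction n with
      | zero => simp
      | succ n ih =>
        refine ih.trans (SimpleGraph.Adj.reachable ?_)
        rw [SimpleGraph.deleteEdges_adj]
        refine ⟨by simpa using hvc.2 (n : ZMod g), ?_⟩
        rintro rfl
        exact he ⟨n, by push_cast; rfl⟩
    intro i
    simpa using this i.val
  have hdown : ∀ a b : V, s(a, b) ∉ cycleEdges g vc → ∀ n x, h x = n →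
      (h a = h b ∨ n < h a) → (G.deleteEdges {s(a, b)}).Reachable (vc 0) x := by
    intro a b he n
    induction n with
    | zero =>
      intro x hx _
      obtain ⟨i, rfl⟩ := h_zero x hx
      exact hcyc _ he i
    | succ n ih =>
      intro x hx hn
      obtain ⟨y, hxy, hy⟩ := h_low x (by omega)
      refine (ih y (by omega) (by omega)).trans (SimpleGraph.Adj.reachable ?_)
      rw [SimpleGraph.deleteEdges_adj]
      refine ⟨hxy.symm, ?_⟩
      simp only [Set.mem_singleton_iff, Sym2.eq_iff, not_or, not_and]
      constructor <;> rintro rfl rfl <;> omega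
  have hne : ∀ a b, G.Adj a b → s(a, b) ∉ cycleEdges g vc → h a ≠ h b := by
    intro a b hab he heq
    exact not_reachable_of_notMem_cycleEdges hG hg hvc hab he
      ((hdown a b he _ a rfl (Or.inl heq)).symm.trans (hdown a b he _ b rfl (Or.inl heq)))
  have hoff : ∀ a b, 0 < h a → s(a, b) ∉ cycleEdges g vc := by
    rintro a b ha ⟨i, hi⟩
    rcases Sym2.eq_iff.1 hi with ⟨rfl, rfl⟩ | ⟨rfl, rfl⟩ <;> rw [h_vc] at ha <;> omega
  have huniq : ∀ x y z, G.Adj x y → G.Adj x z → h y < h x → h z < h x → y = z := by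
    intro x y z hxy hxz hy hz
    by_contra hyz
    have he := hoff x y (by omega)
    refine not_reachable_of_notMem_cycleEdges hG hg hvc hxy he (SimpleGraph.Reachable.symm ?_)
    refine ((hdown x y he _ y rfl (Or.inr hy)).symm.trans
      (hdown x y he _ z rfl (Or.inr hz))).trans (SimpleGraph.Adj.reachable ?_)
    rw [SimpleGraph.deleteEdges_adj]
    refine ⟨hxz.symm, ?_⟩
    simp only [Set.mem_singleton_iff, Sym2.eq_iff, not_or, not_and]
    exact ⟨fun h => absurd h.symm hxz.ne, fun h => absurd h.symm hyz⟩
  have hpar : ∀ x, ∃ p, (h x = 0 → p = x) ∧ (0 < h x → G.Adj x p ∧ h p + 1 = h x) := by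
    intro x
    rcases Nat.eq_zero_or_pos (h x) with h0 | h0
    · exact ⟨x, fun _ => rfl, fun h1 => by omega⟩
    · obtain ⟨y, hy⟩ := h_low x h0
      exact ⟨y, fun h1 => by omega, fun _ => hy⟩
  choose par hpar0 hpar1 using hpar
  have hix : ∀ n x, h x = n → ∃ i, vc i = par^[n] x := by
    intro n
    induction n with
    | zero => exact fun x hx => h_zero x hx
    | succ n ih =>
      intro x hx
      have := (hpar1 x (by omega)).2
      exact ih (par x) (by omega)
  choose! ix0 hix0 using hix
  set ix : V → ZMod g := fun x => ix0 (h x) x with hixd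
  have hix1 : ∀ x, vc (ix x) = par^[h x] x := fun x => hix0 _ x rfl
  have vc_ix : ∀ x, h x = 0 → vc (ix x) = x := fun x hx => by rw [hix1, hx]; rfl
  refine ⟨par, h, ix, hvc, hconn, h_vc, fun i => hvc.1 (vc_ix _ (h_vc i)), vc_ix, hpar0,
    fun x hx => (hpar1 x hx).1, fun x hx => (hpar1 x hx).2, ?_, ?_⟩
  · intro x
    rcases Nat.eq_zero_or_pos (h x) with h0 | h0
    · rw [hpar0 x h0]
    · apply hvc.1
      rw [hix1, hix1, ← (hpar1 x h0).2]
      rfl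
  · intro x y hxy
    by_cases he : s(x, y) ∈ cycleEdges g vc
    · right; right
      obtain ⟨i, hi⟩ := he
      rcases Sym2.eq_iff.1 hi with ⟨rfl, rfl⟩ | ⟨rfl, rfl⟩
      · exact ⟨h_vc _, h_vc _, Or.inl (by
          rw [hvc.1 (vc_ix _ (h_vc i)), hvc.1 (vc_ix _ (h_vc (i + 1)))])⟩
      · exact ⟨h_vc _, h_vc _, Or.inr (by
          rw [hvc.1 (vc_ix _ (h_vc i)), hvc.1 (vc_ix _ (h_vc (i + 1)))])⟩
    · rcases lt_or_gt_of_ne (hne x y hxy he) with h1 | h1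
      · right; left
        have := hpar1 y (by omega)
        exact ⟨by omega, huniq y _ _ this.1 hxy.symm (by omega) h1⟩
      · left
        have := hpar1 x (by omega)
        exact ⟨by omega, huniq x _ _ this.1 hxy (by omega) h1⟩

end Rooting

/-! ### Distances in a rooted unicyclic graph -/

/-- The distance between two indices along a cycle of length `g`. -/
def cycDist {g : ℕ} (p q : ZMod g) : ℕ :=
  min (p.val - q.val + (q.val - p.val)) (g - (p.val - q.val + (q.val - p.val)))

theorem cycDist_comm {g : ℕ} (p q : ZMod g) : cycDist p q = cycDist q p := by
  unfold cycDist
  rw [add_comm]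

theorem cycDist_add_one {g : ℕ} (hg : 3 ≤ g) (p i : ZMod g) :
    cycDist p (i + 1) ≤ cycDist p i + 1 ∧ cycDist p i ≤ cycDist p (i + 1) + 1 := by
  have : NeZero g := ⟨by omega⟩
  have h1 := ZMod.val_lt p
  have h2 := ZMod.val_lt i
  unfold cycDist
  rcases val_add_one_cases hg i with h | h <;> rw [h.2] <;> omega

/-- `z` lies in the subtree hanging from `x`. -/
def Below {V : Type*} (par : V → V) (x z : V) : Prop := ∃ k : ℕ, par^[k] z = x

namespace CycleRooting

variable {V : Type*} {G : SimpleGraph V} {g : ℕ} {vc : ZMod g → V} {par : V → V} {h : V → ℕ}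
  {ix : V → ZMod g}

theorem below_refl (x : V) : Below par x x := ⟨0, rfl⟩

theorem below_trans {x y z : V} (hxy : Below par x y) (hyz : Below par y z) : Below par x z := by
  obtain ⟨k, rfl⟩ := hxy
  obtain ⟨l, rfl⟩ := hyz
  exact ⟨k + l, Function.iterate_add_apply _ _ _ _⟩

theorem below_par {x z : V} (hxz : Below par x (par z)) : Below par x z :=
  below_trans hxz ⟨1, rfl⟩

theorem par_below {x z : V} (hxz : Below par x z) (hne : z ≠ x) : Below par x (par z) := by
  obtain ⟨k, hk⟩ := hxz
  cases k with
  | zero => exact absurd hk hne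
  | succ k => exact ⟨k, hk⟩

theorem below_total {x y z : V} (hx : Below par x z) (hy : Below par y z) :
    Below par x y ∨ Below par y x := by
  obtain ⟨k, rfl⟩ := hx
  obtain ⟨l, rfl⟩ := hy
  rcases le_total k l with hkl | hkl
  · right
    exact ⟨l - k, by rw [← Function.iterate_add_apply, Nat.sub_add_cancel hkl]⟩
  · left
    exact ⟨k - l, by rw [← Function.iterate_add_apply, Nat.sub_add_cancel hkl]⟩

variable (R : CycleRooting G g vc par h ix)
include R

theorem h_par_le (z : V) : h (par z) ≤ h z := by
  rcases Nat.eq_zero_or_pos (h z) with h0 | h0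
  · rw [R.par_zero z h0]
  · have := R.h_par z h0
    omega

theorem h_le_of_below {x z : V} (hxz : Below par x z) : h x ≤ h z := by
  obtain ⟨k, rfl⟩ := hxz
  induction k with
  | zero => exact le_rfl
  | succ k ih =>
    rw [Function.iterate_succ_apply']
    exact (R.h_par_le _).trans ih

theorem ix_of_below {x z : V} (hxz : Below par x z) : ix z = ix x := by
  obtain ⟨k, rfl⟩ := hxz
  induction k with
  | zero => rfl
  | succ k ih => rw [Function.iterate_succ_apply', R.ix_par, ih]

theorem eq_of_below_of_h_eq {x z : V} (hxz : Below par x z) (hh : h z ≤ h x) : z = x := by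
  by_contra hne
  have h1 := R.h_le_of_below (par_below hxz hne)
  rcases Nat.eq_zero_or_pos (h z) with h0 | h0
  · obtain ⟨k, hk⟩ := hxz
    rw [Function.iterate_fixed (R.par_zero z h0)] at hk
    exact hne hk
  · have := R.h_par z h0
    omega

theorem not_below_par {x : V} (hx : 0 < h x) : ¬ Below par x (par x) := by
  intro hb
  have h1 := R.h_le_of_below hb
  have := R.h_par x hx
  omega

theorem below_vc_ix (z : V) : Below par (vc (ix z)) z := by
  suffices ∀ n z, h z = n → Below par (vc (ix z)) z from this _ z rfl
  intro n
  induction n with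
  | zero =>
    intro z hz
    rw [R.vc_ix z hz]
    exact below_refl _
  | succ n ih =>
    intro z hz
    have := R.h_par z (by omega)
    have h1 := ih (par z) (by omega)
    rw [R.ix_par] at h1
    exact below_par h1

/-- A subtree can only be left through the edge from its top vertex to the parent. -/
theorem eq_of_adj_of_not_below {x z n : V} (hx : 0 < h x) (hz : Below par x z)
    (hn : ¬ Below par x n) (hadj : G.Adj z n) : z = x ∧ par x = n := by
  rcases R.adj_cases z n hadj with ⟨-, rfl⟩ | ⟨-, rfl⟩ | ⟨h0, -⟩
  · by_cases hzx : z = x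
    · exact ⟨hzx, by rw [hzx]⟩
    · exact absurd (par_below hz hzx) hn
  · exact absurd (below_par hz) hn
  · have := R.h_le_of_below hz
    omega

theorem dist_eq_of_cut {x s u : V} (hx : 0 < h x) (hs : Below par x s) (hu : ¬ Below par x u) :
    G.dist s u = G.dist s x + 1 + G.dist (par x) u := by
  have hlow : ∀ (s u : V) (w : G.Walk s u), Below par x s → ¬ Below par x u →
      G.dist s x + 1 + G.dist (par x) u ≤ w.length := by
    intro s u w
    induction w with
    | nil => exact fun h1 h2 => absurd h1 h2
    | @cons s n u hsn p ih =>
      intro hs hu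
      rw [SimpleGraph.Walk.length_cons]
      by_cases hn : Below par x n
      · have h1 := ih hn hu
        have h2 := R.conn.dist_triangle (u := s) (v := n) (w := x)
        rw [SimpleGraph.dist_eq_one_iff_adj.2 hsn] at h2
        omega
      · obtain ⟨rfl, rfl⟩ := R.eq_of_adj_of_not_below hx hs hn hsn
        have := SimpleGraph.dist_le p
        rw [SimpleGraph.dist_self]
        omega
  apply le_antisymm
  · have h1 := R.conn.dist_triangle (u := s) (v := x) (w := u)
    have h2 := R.conn.dist_triangle (u := x) (v := par x) (w := u)
    rw [SimpleGraph.dist_eq_one_iff_adj.2 (R.adj_par x hx)] at h2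
    omega
  · obtain ⟨w, hw⟩ := R.conn.exists_walk_length_eq_dist s u
    rw [← hw]
    exact hlow s u w hs hu

/-- Outside the subtree of `x`, the vertex `x` is one step further than its parent. -/
theorem dist_eq_dist_par_add_one {x s : V} (hx : 0 < h x) (hs : ¬ Below par x s) :
    G.dist s x = G.dist s (par x) + 1 := by
  have := R.dist_eq_of_cut hx (below_refl x) hs
  rw [SimpleGraph.dist_self] at this
  rw [SimpleGraph.dist_comm, this, SimpleGraph.dist_comm (u := s)]
  omega

theorem dist_of_below {x z : V} (hxz : Below par x z) : G.dist x z + h x = h z := by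
  suffices ∀ n z, h z = n → Below par x z → G.dist x z + h x = h z from this _ z rfl hxz
  intro n
  induction n with
  | zero =>
    intro z hz hxz
    have := R.eq_of_below_of_h_eq hxz (by omega)
    simp [this]
  | succ n ih =>
    intro z hz hxz
    by_cases hzx : z = x
    · simp [hzx]
    · have hp := R.h_par z (by omega)
      have h1 := ih (par z) (by omega) (par_below hxz hzx)
      have hnb : ¬ Below par z x := fun hb =>
        hzx (R.eq_of_below_of_h_eq hxz (R.h_le_of_below hb))
      rw [R.dist_eq_dist_par_add_one (by omega) hnb]
      omega

theorem dist_vc_add (i : ZMod g) (n : ℕ) : G.dist (vc i) (vc (i + n)) ≤ n := by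
  induction n with
  | zero => simp
  | succ n ih =>
    have h1 := R.conn.dist_triangle (u := vc i) (v := vc (i + n)) (w := vc (i + (n + 1 : ℕ)))
    have h2 : G.Adj (vc (i + n)) (vc (i + (n + 1 : ℕ))) := by
      have := R.labelling.2 (i + n)
      rwa [add_assoc, ← Nat.cast_succ] at this
    rw [SimpleGraph.dist_eq_one_iff_adj.2 h2] at h1
    omega

theorem dist_vc_le (hg : 3 ≤ g) (i j : ZMod g) : G.dist (vc i) (vc j) ≤ cycDist i j := by
  have : NeZero g := ⟨by omega⟩
  wlog hij : i.val ≤ j.val generalizing i j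
  · rw [SimpleGraph.dist_comm, cycDist_comm]
    exact this j i (by omega)
  have hj := ZMod.val_lt j
  have h1 := R.dist_vc_add i (j.val - i.val)
  have h2 := R.dist_vc_add j (g - (j.val - i.val))
  have e1 : i + ((j.val - i.val : ℕ) : ZMod g) = j := by
    rw [Nat.cast_sub hij, ZMod.natCast_zmod_val, ZMod.natCast_zmod_val]
    ring
  have e2 : j + ((g - (j.val - i.val) : ℕ) : ZMod g) = i := by
    rw [Nat.cast_sub (by omega), Nat.cast_sub hij, ZMod.natCast_zmod_val, ZMod.natCast_zmod_val,
      ZMod.natCast_self]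
    ring
  rw [e1] at h1
  rw [e2, SimpleGraph.dist_comm] at h2
  unfold cycDist
  omega

theorem cycDist_le_dist (hg : 3 ≤ g) (x y : V) : cycDist (ix x) (ix y) ≤ G.dist x y := by
  have hlow : ∀ (p : ZMod g) (x y : V) (w : G.Walk x y),
      cycDist p (ix y) ≤ cycDist p (ix x) + w.length := by
    intro p x y w
    induction w with
    | nil => simp
    | @cons x n y hxn w ih =>
      rw [SimpleGraph.Walk.length_cons]
      have : cycDist p (ix n) ≤ cycDist p (ix x) + 1 := by
        rcases R.adj_cases x n hxn with ⟨-, rfl⟩ | ⟨-, rfl⟩ | ⟨-, -, h1 | h1⟩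
        · rw [R.ix_par]; omega
        · rw [R.ix_par]; omega
        · rw [h1]; exact (cycDist_add_one hg p _).1
        · rw [h1]; exact (cycDist_add_one hg p _).2
      omega
  obtain ⟨w, hw⟩ := R.conn.exists_walk_length_eq_dist x y
  have h1 := hlow (ix x) x y w
  have h2 : cycDist (ix x) (ix x) = 0 := by simp [cycDist]
  omega

theorem dist_root (x : V) : G.dist (vc (ix x)) x = h x := by
  have := R.dist_of_below (R.below_vc_ix x)
  rwa [R.h_vc] at this

theorem dist_le_add (hg : 3 ≤ g) (s u : V) :
    G.dist s u ≤ h s + cycDist (ix s) (ix u) + h u := by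
  have h1 := R.conn.dist_triangle (u := s) (v := vc (ix s)) (w := u)
  have h2 := R.conn.dist_triangle (u := vc (ix s)) (v := vc (ix u)) (w := u)
  have h3 := R.dist_root s
  rw [SimpleGraph.dist_comm] at h3
  have h4 := R.dist_root u
  have h5 := R.dist_vc_le hg (ix s) (ix u)
  omega

/-- The distance between vertices of different trees. -/
theorem dist_eq_add (hg : 3 ≤ g) {s u : V} (hsu : ix s ≠ ix u) :
    G.dist s u = h s + cycDist (ix s) (ix u) + h u := by
  refine le_antisymm (R.dist_le_add hg s u) ?_
  suffices ∀ n s u, h s + h u = n → ix s ≠ ix u →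
      h s + cycDist (ix s) (ix u) + h u ≤ G.dist s u from this _ s u rfl hsu
  intro n
  induction n with
  | zero =>
    intro s u hn _
    have := R.cycDist_le_dist hg s u
    omega
  | succ n ih =>
    intro s u hn hsu
    have key : ∀ s u, h s + h u = n + 1 → 0 < h s → ix s ≠ ix u →
        h s + cycDist (ix s) (ix u) + h u ≤ G.dist s u := by
      intro s u hn hs hsu
      have h1 := R.h_par s hs
      have h2 := ih (par s) u (by omega) (by rwa [R.ix_par])
      rw [R.ix_par] at h2
      have h3 := R.dist_eq_of_cut hs (below_refl s) (fun hb => hsu (R.ix_of_below hb).symm)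
      omega
    rcases Nat.eq_zero_or_pos (h s) with h0 | h0
    · have := key u s (by omega) (by omega) hsu.symm
      rw [SimpleGraph.dist_comm, cycDist_comm]
      omega
    · exact key s u hn h0 hsu

theorem dist_vc (hg : 3 ≤ g) (s : V) (i : ZMod g) :
    G.dist s (vc i) = h s + cycDist (ix s) i := by
  by_cases hi : ix s = i
  · subst hi
    rw [SimpleGraph.dist_comm, R.dist_root]
    simp [cycDist]
  · rw [R.dist_eq_add hg (by rwa [R.ix_vc]), R.ix_vc, R.h_vc, add_zero]

end CycleRooting

/-! ### Geodesic triples on a cycle -/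

section GeodesicTriple

/-- `x < y < z` cut a cycle of length `g` into three arcs, none longer than half of the cycle. -/
def NatTriple (g x y z : ℕ) : Prop :=
  x < y ∧ y < z ∧ z < g ∧ 2 * (y - x) ≤ g ∧ 2 * (z - y) ≤ g ∧ g ≤ 2 * (z - x)

/-- The distance between two positions on a cycle of length `g`. -/
def natDist (g x y : ℕ) : ℕ := min (x - y + (y - x)) (g - (x - y + (y - x)))

theorem exists_natTriple {g s t : ℕ} (hg : 3 ≤ g) (hst : s < t) (ht : t < g) :
    ∃ k < g, NatTriple g s t k ∨ NatTriple g k s t ∨ NatTriple g s k t := by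
  unfold NatTriple
  by_cases h1 : 2 * (t - s) ≤ g
  · by_cases h2 : 2 * (t - s) = g
    · by_cases h3 : t + 1 < g
      · exact ⟨t + 1, by omega, by omega⟩
      · exact ⟨0, by omega, by omega⟩
    · by_cases h3 : s + (g + 1) / 2 < g
      · exact ⟨s + (g + 1) / 2, by omega, by omega⟩
      · exact ⟨s + (g + 1) / 2 - g, by omega, by omega⟩
  · exact ⟨s + g / 2, by omega, by omega⟩

theorem NatTriple.lt {g x y z : ℕ} (ht : NatTriple g x y z) {a : ℕ}
    (ha : a = x ∨ a = y ∨ a = z) : a < g := by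
  unfold NatTriple at ht
  omega

theorem natDist_comm (g x y : ℕ) : natDist g x y = natDist g y x := by
  unfold natDist
  rw [add_comm]

theorem natDist_triangle {g x y z : ℕ} (hx : x < g) (hy : y < g) (hz : z < g) :
    natDist g x z ≤ natDist g x y + natDist g y z := by
  unfold natDist
  omega

theorem natDist_cases {g x y : ℕ} (hx : x < g) (hy : y < g) :
    2 * natDist g x y ≤ g ∧ (natDist g x y + x = y ∨ natDist g x y + y = x ∨
      natDist g x y + y = g + x ∨ natDist g x y + x = g + y) := by
  unfold natDist
  omega

/-- The distance from `x` to the edge joining `q` to its successor `r`. -/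
theorem min_natDist_cases {g x q r : ℕ} (hx : x < g) (hq : q < g)
    (hqr : (q + 1 < g ∧ r = q + 1) ∨ (q + 1 = g ∧ r = 0)) :
    2 * min (natDist g x q) (natDist g x r) + 1 ≤ g ∧
      (min (natDist g x q) (natDist g x r) + x = q ∨
        min (natDist g x q) (natDist g x r) + q + 1 = x ∨
        min (natDist g x q) (natDist g x r) + q + 1 = g + x ∨
        min (natDist g x q) (natDist g x r) + x = g + q) := by
  unfold natDist
  omega

/-- The position of `q` relative to the three arcs of a triple. -/
theorem NatTriple.arc_cases {g x y z q : ℕ} (ht : NatTriple g x y z) (hq : q < g) :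
    (x ≤ q ∧ q ≤ y ∧ natDist g x q + x = q ∧ natDist g y q + q = y) ∨
    (y ≤ q ∧ q ≤ z ∧ natDist g y q + y = q ∧ natDist g z q + q = z) ∨
    (z ≤ q ∧ natDist g z q + z = q ∧ natDist g x q + q = g + x) ∨
    (q ≤ x ∧ natDist g x q + q = x ∧ natDist g z q + z = g + q) := by
  have hx := natDist_cases (ht.lt (a := x) (by simp)) hq
  have hy := natDist_cases (ht.lt (a := y) (by simp)) hq
  have hz := natDist_cases (ht.lt (a := z) (by simp)) hq
  unfold NatTriple at ht
  generalize natDist g x q = mx at *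
  generalize natDist g y q = my at *
  generalize natDist g z q = mz at *
  rcases Nat.lt_or_ge q x with h1 | h1
  · exact Or.inr (Or.inr (Or.inr (by omega)))
  rcases Nat.lt_or_ge q y with h2 | h2
  · exact Or.inl (by omega)
  rcases Nat.lt_or_ge q z with h3 | h3
  · exact Or.inr (Or.inl (by omega))
  · exact Or.inr (Or.inr (Or.inl (by omega)))

theorem NatTriple.edge_cases {g x y z q r : ℕ} (ht : NatTriple g x y z) (hq : q < g)
    (hqr : (q + 1 < g ∧ r = q + 1) ∨ (q + 1 = g ∧ r = 0)) {m : ℕ → ℕ}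
    (hm : m = fun a => min (natDist g a q) (natDist g a r)) :
    (x ≤ q ∧ q < y ∧ m x + x = q ∧ m y + q + 1 = y) ∨
    (y ≤ q ∧ q < z ∧ m y + y = q ∧ m z + q + 1 = z) ∨
    (z ≤ q ∧ m z + z = q ∧ m x + q + 1 = g + x) ∨
    (q < x ∧ m x + q + 1 = x ∧ m z + z = g + q) := by
  unfold NatTriple at ht
  have hx := min_natDist_cases (show x < g by omega) hq hqr
  have hy := min_natDist_cases (show y < g by omega) hq hqr
  have hz := min_natDist_cases (show z < g by omega) hq hqr
  subst hm
  dsimp only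
  generalize min (natDist g x q) (natDist g x r) = mx at *
  generalize min (natDist g y q) (natDist g y r) = my at *
  generalize min (natDist g z q) (natDist g z r) = mz at *
  clear hqr
  rcases Nat.lt_or_ge q x with h1 | h1
  · exact Or.inr (Or.inr (Or.inr (by omega)))
  rcases Nat.lt_or_ge q y with h2 | h2
  · exact Or.inl (by omega)
  rcases Nat.lt_or_ge q z with h3 | h3
  · exact Or.inr (Or.inl (by omega))
  · exact Or.inr (Or.inr (Or.inl (by omega)))

theorem NatTriple.dist_eqs {g x y z : ℕ} (ht : NatTriple g x y z) :
    natDist g x y + x = y ∧ natDist g y z + y = z ∧ natDist g x z + z = g + x := by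
  unfold NatTriple at ht
  unfold natDist
  omega

/-- Every position lies on a geodesic between two members of a triple. -/
theorem NatTriple.exists_arc {g x y z q : ℕ} (ht : NatTriple g x y z) (hq : q < g) :
    ∃ a b, a ≠ b ∧ (a = x ∨ a = y ∨ a = z) ∧ (b = x ∨ b = y ∨ b = z) ∧
      natDist g a q + natDist g b q = natDist g a b := by
  have h1 := ht.dist_eqs
  have h2 := ht.arc_cases hq
  have h3 := natDist_comm g x z
  unfold NatTriple at ht
  rcases h2 with h2 | h2 | h2 | h2
  · exact ⟨x, y, by omega, by omega, by omega, by omega⟩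
  · exact ⟨y, z, by omega, by omega, by omega, by omega⟩
  · exact ⟨x, z, by omega, by omega, by omega, by omega⟩
  · exact ⟨x, z, by omega, by omega, by omega, by omega⟩

theorem NatTriple.exists_edge_arc {g x y z q r : ℕ} (ht : NatTriple g x y z) (hq : q < g)
    (hqr : (q + 1 < g ∧ r = q + 1) ∨ (q + 1 = g ∧ r = 0)) :
    ∃ a b, a ≠ b ∧ (a = x ∨ a = y ∨ a = z) ∧ (b = x ∨ b = y ∨ b = z) ∧
      min (natDist g a q) (natDist g a r) + min (natDist g b q) (natDist g b r) + 1
        = natDist g a b := by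
  have h1 := ht.dist_eqs
  have h2 := ht.edge_cases hq hqr rfl
  unfold NatTriple at ht
  rcases h2 with h2 | h2 | h2 | h2
  · exact ⟨x, y, by omega, by omega, by omega, by omega⟩
  · exact ⟨y, z, by omega, by omega, by omega, by omega⟩
  · exact ⟨x, z, by omega, by omega, by omega, by omega⟩
  · exact ⟨x, z, by omega, by omega, by omega, by omega⟩

/-- The distances to a triple determine the position. -/
theorem NatTriple.eq_of_natDist_eq {g x y z p q : ℕ} (ht : NatTriple g x y z) (hp : p < g)
    (hq : q < g) (H : ∀ a, a = x ∨ a = y ∨ a = z → natDist g a p = natDist g a q) : p = q := by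
  have hx := H x (by simp)
  have hy := H y (by simp)
  have hz := H z (by simp)
  have cp := ht.arc_cases hp
  have cq := ht.arc_cases hq
  have bx := natDist_cases (ht.lt (a := x) (by simp)) hp
  have dy := natDist_cases (ht.lt (a := y) (by simp)) hp
  have dz := natDist_cases (ht.lt (a := z) (by simp)) hp
  have dx' := natDist_cases (ht.lt (a := x) (by simp)) hq
  have dy' := natDist_cases (ht.lt (a := y) (by simp)) hq
  have dz' := natDist_cases (ht.lt (a := z) (by simp)) hq
  clear H
  unfold NatTriple at ht
  generalize natDist g x p = xp at *
  generalize natDist g y p = yp at *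
  generalize natDist g z p = zp at *
  subst hx hy hz
  rcases cp with cp | cp | cp | cp <;> rcases cq with cq | cq | cq | cq <;> omega

/-- The distances to a triple determine the edge. -/
theorem NatTriple.cycle_cycle {g x y z p q r s : ℕ} (ht : NatTriple g x y z) (hp : p < g)
    (hq : q < g) (hpr : (p + 1 < g ∧ r = p + 1) ∨ (p + 1 = g ∧ r = 0))
    (hqs : (q + 1 < g ∧ s = q + 1) ∨ (q + 1 = g ∧ s = 0))
    (H : ∀ a, a = x ∨ a = y ∨ a = z →
      min (natDist g a p) (natDist g a r) = min (natDist g a q) (natDist g a s)) : p = q := by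
  have hx := H x (by simp)
  have hy := H y (by simp)
  have hz := H z (by simp)
  have cp := ht.edge_cases hp hpr rfl
  have cq := ht.edge_cases hq hqs rfl
  have bx := min_natDist_cases (ht.lt (a := x) (by simp)) hp hpr
  have dy := min_natDist_cases (ht.lt (a := y) (by simp)) hp hpr
  have dz := min_natDist_cases (ht.lt (a := z) (by simp)) hp hpr
  have dx' := min_natDist_cases (ht.lt (a := x) (by simp)) hq hqs
  have dy' := min_natDist_cases (ht.lt (a := y) (by simp)) hq hqs
  have dz' := min_natDist_cases (ht.lt (a := z) (by simp)) hq hqs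
  clear H hpr hqs
  unfold NatTriple at ht
  generalize min (natDist g x p) (natDist g x r) = xp at *
  generalize min (natDist g y p) (natDist g y r) = yp at *
  generalize min (natDist g z p) (natDist g z r) = zp at *
  subst hx hy hz
  rcases cp with cp | cp | cp | cp <;> rcases cq with cq | cq | cq | cq <;> omega

theorem NatTriple.tree_le {g x y z p q H K : ℕ} (ht : NatTriple g x y z) (hp : p < g)
    (hq : q < g) (hpq : p ≠ q)
    (H1 : ∀ a, a = x ∨ a = y ∨ a = z →
      (a ≠ q → natDist g a q + K ≤ natDist g a p + H) ∧
      (a ≠ p → natDist g a p + H ≤ natDist g a q + K)) : H ≤ K := by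
  obtain ⟨a, b, hab, ha, hb, heq⟩ := ht.exists_arc hq
  have h1 := H1 a ha
  have h2 := H1 b hb
  have h3 := natDist_triangle (ht.lt ha) hp (ht.lt hb)
  rw [natDist_comm g p b] at h3
  have h0 : ∀ c, natDist g c c = 0 := fun c => by simp [natDist]
  by_cases hap : a = p
  · subst hap
    have e1 := h1.1 hpq
    have e2 := h2.2 hab.symm
    rw [h0] at *
    omega
  · by_cases hbp : b = p
    · subst hbp
      have e1 := h2.1 hpq
      have e2 := h1.2 hab
      rw [h0] at *
      omega
    · have e1 := h1.2 hap
      have e2 := h2.2 hbp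
      omega

/-- Two trees hanging at different positions cannot have the same distances to a triple. -/
theorem NatTriple.tree_tree {g x y z p q H K : ℕ} (ht : NatTriple g x y z) (hp : p < g)
    (hq : q < g) (hpq : p ≠ q)
    (H1 : ∀ a, a = x ∨ a = y ∨ a = z →
      (a ≠ q → natDist g a q + K ≤ natDist g a p + H) ∧
      (a ≠ p → natDist g a p + H ≤ natDist g a q + K)) : False := by
  have e1 := ht.tree_le hp hq hpq H1
  have e2 := ht.tree_le hq hp hpq.symm (fun a ha => (H1 a ha).symm)
  refine hpq (ht.eq_of_natDist_eq hp hq fun a ha => ?_)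
  have h0 : ∀ c, natDist g c c = 0 := fun c => by simp [natDist]
  have h1 := H1 a ha
  by_cases hap : a = p
  · subst hap
    have := h1.1 hpq
    rw [h0] at *
    omega
  · by_cases haq : a = q
    · subst haq
      have := h1.2 hap
      rw [h0] at *
      omega
    · have := h1.1 haq
      have := h1.2 hap
      omega

/-- An edge of a tree and an edge of the cycle cannot have the same distances to a triple. -/
theorem NatTriple.tree_cycle {g x y z p q r H : ℕ} (ht : NatTriple g x y z) (hp : p < g)
    (hq : q < g) (hqr : (q + 1 < g ∧ r = q + 1) ∨ (q + 1 = g ∧ r = 0))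
    (H1 : ∀ a, a = x ∨ a = y ∨ a = z → a ≠ p →
      natDist g a p + H ≤ min (natDist g a q) (natDist g a r)) : False := by
  obtain ⟨a, b, hab, ha, hb, heq⟩ := ht.exists_edge_arc hq hqr
  have h1 := H1 a ha
  have h2 := H1 b hb
  have h3 := natDist_triangle (ht.lt ha) hp (ht.lt hb)
  rw [natDist_comm g p b] at h3
  generalize min (natDist g a q) (natDist g a r) = ma at *
  generalize min (natDist g b q) (natDist g b r) = mb at *
  by_cases hap : a = p
  · subst hap
    have := h2 hab.symm
    rw [natDist_comm g b a] at this
    omega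
  · have e1 := h1 hap
    by_cases hbp : b = p
    · subst hbp
      omega
    · have := h2 hbp
      omega

end GeodesicTriple

theorem add_one_ne_sub_one {g : ℕ} (hg : 3 ≤ g) (i : ZMod g) : i + 1 ≠ i - 1 := by
  intro heq
  have h1 : ((2 : ℕ) : ZMod g) = 0 := by
    have : i + 1 - (i - 1) = 0 := by rw [heq, sub_self]
    push_cast
    rw [← this]
    ring
  rw [ZMod.natCast_eq_zero_iff] at h1
  have := Nat.le_of_dvd (by norm_num) h1
  omega

/-! ### Threads as descending paths -/

/-- `x :: t` descends from `x` through vertices of degree two to a leaf. -/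
def Descends {V : Type*} [Fintype V] (G : SimpleGraph V) [DecidableRel G.Adj] (par : V → V)
    (h : V → ℕ) : V → List V → Prop
  | x, [] => G.degree x = 1
  | x, y :: t => G.degree x = 2 ∧ par y = x ∧ 0 < h y ∧ Descends G par h y t

/-- The children of `x`. -/
def children {V : Type*} [Fintype V] [DecidableEq V] (par : V → V) (h : V → ℕ) (x : V) :
    Finset V :=
  Finset.univ.filter fun y => par y = x ∧ 0 < h y

theorem mem_children {V : Type*} [Fintype V] [DecidableEq V] {par : V → V} {h : V → ℕ}
    {x y : V} : y ∈ children par h x ↔ par y = x ∧ 0 < h y := by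
  simp [children]

theorem below_of_mem_children {V : Type*} [Fintype V] [DecidableEq V] {par : V → V} {h : V → ℕ}
    {x y : V} (hy : y ∈ children par h x) : Below par x y :=
  ⟨1, (mem_children.1 hy).1⟩

theorem degree_le_two_of_descends {V : Type*} [Fintype V] {G : SimpleGraph V} [DecidableRel G.Adj]
    {par : V → V} {h : V → ℕ} {t : List V} : ∀ {u : V}, Descends G par h u t →
    ∀ z ∈ u :: t, G.degree z ≤ 2 := by
  induction t with
  | nil =>
    intro u ht z hz
    rw [List.mem_singleton] at hz
    have h2 : G.degree u = 1 := ht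
    rw [hz]
    omega
  | cons y t ih =>
    intro u ht z hz
    obtain ⟨h2, -, -, h5⟩ := ht
    rcases List.mem_cons.1 hz with rfl | hz
    · omega
    · exact ih h5 z hz

namespace CycleRooting

variable {V : Type*} [Fintype V] [DecidableEq V] {G : SimpleGraph V} {g : ℕ}
  {vc : ZMod g → V} {par : V → V} {h : V → ℕ} {ix : V → ZMod g}
variable (R : CycleRooting G g vc par h ix)
include R

theorem h_of_mem_children {x y : V} (hy : y ∈ children par h x) : h x + 1 = h y := by
  obtain ⟨rfl, h1⟩ := mem_children.1 hy
  exact R.h_par y h1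

theorem exists_child_of_below {x z : V} (hxz : Below par x z) (hne : z ≠ x) :
    ∃ y ∈ children par h x, Below par y z := by
  obtain ⟨k, hk⟩ := hxz
  induction k with
  | zero => exact absurd hk hne
  | succ k ih =>
    rw [Function.iterate_succ_apply'] at hk
    rcases Nat.eq_zero_or_pos (h (par^[k] z)) with h0 | h0
    · rw [R.par_zero _ h0] at hk
      exact ih hk
    · exact ⟨par^[k] z, mem_children.2 ⟨hk, h0⟩, k, rfl⟩

variable [DecidableRel G.Adj]

theorem degree_of_pos {x : V} (hx : 0 < h x) : G.degree x = (children par h x).card + 1 := by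
  have hp : par x ∉ children par h x := fun hc => by
    have := R.h_of_mem_children hc
    have := R.h_par x hx
    omega
  rw [← Finset.card_insert_of_notMem hp, ← SimpleGraph.card_neighborFinset_eq_degree]
  congr 1
  ext y
  rw [SimpleGraph.mem_neighborFinset, Finset.mem_insert, mem_children]
  constructor
  · intro hxy
    rcases R.adj_cases x y hxy with ⟨-, h1⟩ | ⟨h1, h2⟩ | ⟨h1, -⟩
    · exact Or.inl h1.symm
    · exact Or.inr ⟨h2, h1⟩
    · omega
  · rintro (rfl | ⟨rfl, hy⟩)
    · exact R.adj_par x hx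
    · exact (R.adj_par y hy).symm

theorem degree_of_zero (hg : 3 ≤ g) {x : V} (hx : h x = 0) :
    G.degree x = (children par h x).card + 2 := by
  set i := ix x with hi
  have hxi : vc i = x := R.vc_ix x hx
  have hne : vc (i + 1) ≠ vc (i - 1) := fun hc =>
    add_one_ne_sub_one hg i (R.labelling.1 hc)
  have hd : Disjoint {vc (i + 1), vc (i - 1)} (children par h x) := by
    rw [Finset.disjoint_left]
    intro y hy hc
    have h1 := (mem_children.1 hc).2
    simp only [Finset.mem_insert, Finset.mem_singleton] at hy
    rcases hy with rfl | rfl <;> rw [R.h_vc] at h1 <;> omega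
  rw [← SimpleGraph.card_neighborFinset_eq_degree, ← Finset.card_pair hne, add_comm,
    ← Finset.card_union_of_disjoint hd]
  congr 1
  ext y
  simp only [SimpleGraph.mem_neighborFinset, Finset.mem_union, Finset.mem_insert,
    Finset.mem_singleton, mem_children]
  constructor
  · intro hxy
    rcases R.adj_cases x y hxy with ⟨h1, -⟩ | ⟨h1, h2⟩ | ⟨-, h1, h2⟩
    · omega
    · exact Or.inr ⟨h2, h1⟩
    · left
      rw [← R.vc_ix y h1]
      rcases h2 with h2 | h2
      · left; rw [h2]
      · right; rw [hi, h2, add_sub_cancel_right]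
  · rintro ((rfl | rfl) | ⟨rfl, hy⟩)
    · have := R.labelling.2 i
      rwa [hxi] at this
    · have := R.labelling.2 (i - 1)
      rw [sub_add_cancel, hxi] at this
      exact this.symm
    · exact (R.adj_par y hy).symm

theorem card_children_add_one_le (hg : 3 ≤ g) (x : V) :
    (children par h x).card + 1 ≤ G.degree x := by
  rcases Nat.eq_zero_or_pos (h x) with h0 | h0
  · rw [R.degree_of_zero hg h0]
    omega
  · rw [R.degree_of_pos h0]

theorem mem_iff_below_of_descends {t : List V} : ∀ {u : V}, 0 < h u → Descends G par h u t →
    ∀ z, z ∈ u :: t ↔ Below par u z := by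
  induction t with
  | nil =>
    intro u hu ht z
    rw [List.mem_singleton]
    refine ⟨fun hz => hz ▸ below_refl _, fun hz => ?_⟩
    by_contra hne
    obtain ⟨y, hy, -⟩ := R.exists_child_of_below hz hne
    have h1 := R.degree_of_pos hu
    have h2 : G.degree u = 1 := ht
    have := Finset.card_pos.2 ⟨y, hy⟩
    omega
  | cons y t ih =>
    intro u hu ht z
    obtain ⟨h2, h3, h4, h5⟩ := ht
    have hyc : y ∈ children par h u := mem_children.2 ⟨h3, h4⟩
    rw [List.mem_cons, ih h4 h5]
    constructor
    · rintro (rfl | hz)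
      · exact below_refl _
      · exact below_trans (below_of_mem_children hyc) hz
    · intro hz
      by_cases hne : z = u
      · exact Or.inl hne
      · right
        obtain ⟨y', hy', hb⟩ := R.exists_child_of_below hz hne
        have h1 := R.degree_of_pos hu
        have : y' = y := Finset.card_le_one.1 (by omega) _ hy' _ hyc
        rwa [← this]

theorem descends_unique {t : List V} : ∀ {u : V} {t' : List V}, 0 < h u → Descends G par h u t →
    Descends G par h u t' → t = t' := by
  induction t with
  | nil =>
    intro u t' hu ht ht'
    cases t' with
    | nil => rfl
    | cons y t' =>
      have h2 : G.degree u = 1 := ht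
      have := ht'.1
      omega
  | cons y t ih =>
    intro u t' hu ht ht'
    obtain ⟨h2, h3, h4, h5⟩ := ht
    cases t' with
    | nil =>
      have h2 : G.degree u = 1 := ht'
      omega
    | cons y' t' =>
      obtain ⟨-, h3', h4', h5'⟩ := ht'
      have h1 := R.degree_of_pos hu
      have : y' = y := Finset.card_le_one.1 (by omega) _
        (mem_children.2 ⟨h3', h4'⟩) _ (mem_children.2 ⟨h3, h4⟩)
      subst this
      rw [ih h4 h5 h5']

theorem descends_of_path (hg : 3 ≤ g) {t : List V} : ∀ {p u : V}, G.Adj p u →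
    (p :: u :: t).Nodup → List.IsChain G.Adj (u :: t) →
    (∀ x ∈ (u :: t).getLast?, G.degree x = 1) → (∀ x ∈ (u :: t).dropLast, G.degree x = 2) →
    0 < h u ∧ par u = p ∧ Descends G par h u t := by
  induction t with
  | nil =>
    intro p u hpu hnd hch hlast hdrop
    have h1 : G.degree u = 1 := hlast u (by simp)
    have hu : 0 < h u := by
      by_contra h0
      have := R.degree_of_zero hg (x := u) (by omega)
      omega
    refine ⟨hu, ?_, h1⟩
    have h2 := R.degree_of_pos hu
    rcases R.adj_cases u p hpu.symm with ⟨-, h3⟩ | ⟨h3, h4⟩ | ⟨h3, -⟩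
    · exact h3
    · have := Finset.card_pos.2 ⟨p, mem_children.2 ⟨h4, h3⟩⟩
      omega
    · omega
  | cons y t ih =>
    intro p u hpu hnd hch hlast hdrop
    rw [List.isChain_cons_cons] at hch
    have h1 : G.degree u = 2 := hdrop u (by simp)
    obtain ⟨h3, h4, h5⟩ := ih hch.1 (List.nodup_cons.1 hnd).2 hch.2
      (fun x hx => hlast x (by simpa using hx)) (fun x hx => hdrop x (by
        rw [List.dropLast_cons_cons]
        exact List.mem_cons_of_mem _ hx))
    have hyc : y ∈ children par h u := mem_children.2 ⟨h4, h3⟩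
    have hpos := Finset.card_pos.2 ⟨y, hyc⟩
    have hu : 0 < h u := by
      by_contra h0
      have := R.degree_of_zero hg (x := u) (by omega)
      omega
    refine ⟨hu, ?_, h1, h4, h3, h5⟩
    have h2 := R.degree_of_pos hu
    rcases R.adj_cases u p hpu.symm with ⟨-, h6⟩ | ⟨h6, h7⟩ | ⟨h6, -⟩
    · exact h6
    · have : p = y := Finset.card_le_one.1 (by omega) _ (mem_children.2 ⟨h7, h6⟩) _ hyc
      subst this
      simp at hnd
    · omega

theorem exists_descends_of_isThreadAt (hg : 3 ≤ g) {v : V} {t : List V} (ht : IsThreadAt G v t) :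
    ∃ u t', t = u :: t' ∧ u ∈ children par h v ∧ Descends G par h u t' := by
  obtain ⟨h1, h2, h3, -, h5, h6, h7, h8⟩ := ht
  cases t with
  | nil => exact absurd rfl h1
  | cons u t =>
    obtain ⟨e1, e2, e3⟩ := R.descends_of_path hg (h6 u (by simp))
      (List.nodup_cons.2 ⟨h3, h2⟩) h5 h7 h8
    exact ⟨u, t, rfl, mem_children.2 ⟨e2, e1⟩, e3⟩

theorem path_of_descends {t : List V} : ∀ {u : V}, 0 < h u → Descends G par h u t →
    (u :: t).Nodup ∧ List.IsChain G.Adj (u :: t) ∧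
    (∀ x ∈ (u :: t).getLast?, G.degree x = 1) ∧ (∀ x ∈ (u :: t).dropLast, G.degree x = 2) := by
  induction t with
  | nil =>
    intro u hu ht
    have h1 : G.degree u = 1 := ht
    simp [h1]
  | cons y t ih =>
    intro u hu ht
    obtain ⟨h2, h3, h4, h5⟩ := ht
    obtain ⟨e1, e2, e3, e4⟩ := ih h4 h5
    refine ⟨List.nodup_cons.2 ⟨fun hm => ?_, e1⟩, ?_, ?_, ?_⟩
    · rw [R.mem_iff_below_of_descends h4 h5, ← h3] at hm
      exact R.not_below_par h4 hm
    · rw [List.isChain_cons_cons]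
      refine ⟨?_, e2⟩
      rw [← h3]
      exact (R.adj_par y h4).symm
    · intro x hx
      exact e3 x (by simpa using hx)
    · intro x hx
      rw [List.dropLast_cons_cons, List.mem_cons] at hx
      rcases hx with rfl | hx
      · exact h2
      · exact e4 x hx

theorem isThreadAt_of_descends {u v : V} {t : List V} (hv : 3 ≤ G.degree v)
    (hu : u ∈ children par h v) (ht : Descends G par h u t) : IsThreadAt G v (u :: t) := by
  obtain ⟨h1, h2⟩ := mem_children.1 hu
  obtain ⟨e1, e2, e3, e4⟩ := R.path_of_descends h2 ht
  refine ⟨by simp, e1, fun hm => ?_, hv, e2, ?_, e3, e4⟩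
  · rw [R.mem_iff_below_of_descends h2 ht, ← h1] at hm
    exact R.not_below_par h2 hm
  · intro x hx
    simp only [List.head?_cons, Option.mem_def, Option.some.injEq] at hx
    rw [← hx, ← h1]
    exact (R.adj_par u h2).symm

theorem exists_descends {N : ℕ} (hN : ∀ x, h x < N) : ∀ {u : V}, 0 < h u →
    (∀ z, Below par u z → G.degree z ≤ 2) → ∃ t, Descends G par h u t := by
  suffices ∀ n u, N ≤ h u + n → 0 < h u → (∀ z, Below par u z → G.degree z ≤ 2) →
      ∃ t, Descends G par h u t from fun {u} => this N u (by omega)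
  intro n
  induction n with
  | zero =>
    intro u hu
    have := hN u
    omega
  | succ n ih =>
    intro u hn hu hdeg
    have h1 := R.degree_of_pos hu
    have h2 := hdeg u (below_refl u)
    rcases (children par h u).eq_empty_or_nonempty with h3 | ⟨y, hy⟩
    · refine ⟨[], ?_⟩
      rw [h3, Finset.card_empty] at h1
      exact h1
    · have h4 := R.h_of_mem_children hy
      obtain ⟨t, ht⟩ := ih y (by omega) (by omega)
        fun z hz => hdeg z (below_trans (below_of_mem_children hy) hz)
      have h5 := Finset.card_pos.2 ⟨y, hy⟩
      exact ⟨y :: t, by omega, (mem_children.1 hy).1, (mem_children.1 hy).2, ht⟩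

/-- A branch-resolving set meets the subtree of one of any two siblings. -/
theorem exists_below_of_branchResolving (hg : 3 ≤ g) {S : Set V} (hS : BranchResolving G S)
    {w₁ w₂ p : V} (h₁ : w₁ ∈ children par h p) (h₂ : w₂ ∈ children par h p) (hne : w₁ ≠ w₂) :
    ∃ s ∈ S, Below par w₁ s ∨ Below par w₂ s := by
  obtain ⟨N, hN⟩ : ∃ N, ∀ x, h x < N :=
    ⟨Finset.univ.sup h + 1, fun x => Nat.lt_succ_of_le (Finset.le_sup (Finset.mem_univ x))⟩
  suffices ∀ n p, N ≤ h p + n → ∀ w₁ ∈ children par h p, ∀ w₂ ∈ children par h p, w₁ ≠ w₂ →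
      ∃ s ∈ S, Below par w₁ s ∨ Below par w₂ s from this N p (by omega) _ h₁ _ h₂ hne
  intro n
  induction n with
  | zero =>
    intro p hp
    have := hN p
    omega
  | succ n ih =>
    intro p hp w₁ h₁ w₂ h₂ hne
    by_contra! hcon
    have key : ∀ w ∈ children par h p, (∀ s ∈ S, ¬ Below par w s) →
        ∃ t, IsThreadAt G p (w :: t) ∧ Descends G par h w t := by
      intro w hw hfree
      have hpos := (mem_children.1 hw).2
      have hlev := R.h_of_mem_children hw
      obtain ⟨t, ht⟩ := R.exists_descends hN hpos (by
        intro z hz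
        by_contra! hdeg
        have h3 := R.h_le_of_below hz
        have h4 := R.degree_of_pos (show 0 < h z by omega)
        obtain ⟨a, ha, b, hb, hab⟩ := Finset.one_lt_card.1
          (show 1 < (children par h z).card by omega)
        obtain ⟨s, hs, hsb⟩ := ih z (by omega) a ha b hb hab
        rcases hsb with hsb | hsb
        · exact hfree s hs (below_trans hz (below_trans (below_of_mem_children ha) hsb))
        · exact hfree s hs (below_trans hz (below_trans (below_of_mem_children hb) hsb)))
      refine ⟨t, R.isThreadAt_of_descends ?_ hw ht, ht⟩
      have h3 := R.card_children_add_one_le hg p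
      have h4 := Finset.one_lt_card.2 ⟨w₁, h₁, w₂, h₂, hne⟩
      omega
    obtain ⟨t₁, ht₁, hd₁⟩ := key w₁ h₁ fun s hs => (hcon s hs).1
    obtain ⟨t₂, ht₂, hd₂⟩ := key w₂ h₂ fun s hs => (hcon s hs).2
    rcases hS p _ _ ht₁ ht₂ (fun hc => hne (List.cons.inj hc).1) with ⟨s, hs, hm⟩ | ⟨s, hs, hm⟩
    · rw [R.mem_iff_below_of_descends (mem_children.1 h₁).2 hd₁] at hm
      exact (hcon s hs).1 hm
    · rw [R.mem_iff_below_of_descends (mem_children.1 h₂).2 hd₂] at hm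
      exact (hcon s hs).2 hm

/-- Distinct threads are disjoint. -/
theorem thread_unique (hg : 3 ≤ g) {v v' z : V} {t t' : List V} (ht : IsThreadAt G v t)
    (ht' : IsThreadAt G v' t') (hz : z ∈ t) (hz' : z ∈ t') : v = v' ∧ t = t' := by
  have key : ∀ {v v' u u' : V} {t : List V}, 3 ≤ G.degree v' → u ∈ children par h v →
      u' ∈ children par h v' → Descends G par h u t → Below par u u' → u = u' := by
    intro v v' u u' t hv' hu hu' hd hb
    by_contra hne
    have h1 := par_below hb (Ne.symm hne)
    rw [(mem_children.1 hu').1, ← R.mem_iff_below_of_descends (mem_children.1 hu).2 hd] at h1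
    have := degree_le_two_of_descends hd _ h1
    omega
  obtain ⟨u, l, rfl, hu, hd⟩ := R.exists_descends_of_isThreadAt hg ht
  obtain ⟨u', l', rfl, hu', hd'⟩ := R.exists_descends_of_isThreadAt hg ht'
  rw [R.mem_iff_below_of_descends (mem_children.1 hu).2 hd] at hz
  rw [R.mem_iff_below_of_descends (mem_children.1 hu').2 hd'] at hz'
  have huu : u = u' := by
    rcases below_total hz hz' with hb | hb
    · exact key ht'.2.2.2.1 hu hu' hd hb
    · exact (key ht.2.2.2.1 hu' hu hd' hb).symm
  subst huu
  exact ⟨(mem_children.1 hu).1.symm.trans (mem_children.1 hu').1,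
    by rw [R.descends_unique (mem_children.1 hu).2 hd hd']⟩

end CycleRooting

/-! ### Necessary conditions for metric generators -/

theorem edgeDist_mk {V : Type*} (G : SimpleGraph V) (s u w : V) :
    edgeDist G s s(u, w) = min (G.dist s u) (G.dist s w) := rfl

theorem cycDist_self_add_one {g : ℕ} (hg : 3 ≤ g) (p : ZMod g) : cycDist p (p + 1) = 1 := by
  have : NeZero g := ⟨by omega⟩
  have h1 := ZMod.val_lt p
  unfold cycDist
  rcases val_add_one_cases hg p with h | h <;> rw [h.2] <;> omega

theorem cycDist_self_sub_one {g : ℕ} (hg : 3 ≤ g) (p : ZMod g) : cycDist p (p - 1) = 1 := by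
  have := cycDist_self_add_one hg (p - 1)
  rwa [sub_add_cancel, cycDist_comm] at this

namespace CycleRooting

section

variable {V : Type*} {G : SimpleGraph V} {g : ℕ} {vc : ZMod g → V} {par : V → V} {h : V → ℕ}
  {ix : V → ZMod g}

theorem not_cycleEdge (R : CycleRooting G g vc par h ix) {x : V} (hx : 0 < h x) (y : V) :
    s(x, y) ∉ cycleEdges g vc := by
  rintro ⟨i, hi⟩
  rcases Sym2.eq_iff.1 hi with ⟨rfl, -⟩ | ⟨rfl, -⟩
  · simp [R.h_vc] at hx
  · simp [R.h_vc] at hx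

/-- The tree hanging at a cycle vertex consists of the vertices with its index. -/
theorem inTree_iff (R : CycleRooting G g vc par h ix) {i : ZMod g} {x : V} :
    inTree G g vc i x ↔ ix x = i := by
  constructor
  · rintro ⟨w⟩
    have hadj : ∀ a b, (offCycle G g vc).Adj a b → ix a = ix b := by
      intro a b hab
      rw [offCycle, SimpleGraph.deleteEdges_adj] at hab
      rcases R.adj_cases a b hab.1 with ⟨-, rfl⟩ | ⟨-, rfl⟩ | ⟨h1, h2, h3 | h3⟩
      · exact (R.ix_par a).symm
      · exact R.ix_par b
      · refine absurd ⟨ix a, ?_⟩ hab.2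
        rw [← h3, R.vc_ix a h1, R.vc_ix b h2]
      · refine absurd ⟨ix b, ?_⟩ hab.2
        rw [← h3, R.vc_ix a h1, R.vc_ix b h2, Sym2.eq_swap]
    have key : ∀ a b, (offCycle G g vc).Walk a b → ix a = ix b := by
      intro a b w
      induction w with
      | nil => rfl
      | cons hab _ ih => exact (hadj _ _ hab).trans ih
    rw [← key _ _ w, R.ix_vc]
  · suffices ∀ n x, h x = n → (offCycle G g vc).Reachable (vc (ix x)) x from
      fun hx => hx ▸ this _ x rfl
    intro n
    induction n with
    | zero =>
      intro x hx
      rw [R.vc_ix x hx]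
    | succ n ih =>
      intro x hx
      have h0 : 0 < h x := by omega
      have h1 := R.h_par x h0
      have h2 := ih (par x) (by omega)
      rw [R.ix_par] at h2
      refine h2.trans (SimpleGraph.Adj.reachable (SimpleGraph.Adj.symm ?_))
      rw [offCycle, SimpleGraph.deleteEdges_adj]
      exact ⟨R.adj_par x h0, R.not_cycleEdge h0 _⟩

/-- All members of a set in a single tree see the two cycle neighbours of its root alike. -/
theorem exists_ix_ne_of_isVertexMG (R : CycleRooting G g vc par h ix) (hg : 3 ≤ g) {S : Set V}
    (hS : IsVertexMG G S) : ∃ s ∈ S, ∃ s' ∈ S, ix s ≠ ix s' := by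
  by_contra! hcon
  obtain ⟨s₀, hs₀, -⟩ := hS (vc 0) (vc (0 + 1)) (R.labelling.2 0).ne
  obtain ⟨s, hs, hd⟩ := hS (vc (ix s₀ + 1)) (vc (ix s₀ - 1))
    fun hc => add_one_ne_sub_one hg _ (R.labelling.1 hc)
  rw [R.dist_vc hg, R.dist_vc hg, hcon s hs s₀ hs₀, cycDist_self_add_one hg,
    cycDist_self_sub_one hg] at hd
  exact hd rfl

theorem exists_ix_ne_of_isEdgeMG (R : CycleRooting G g vc par h ix) (hg : 3 ≤ g) {S : Set V}
    (hS : IsEdgeMG G S) : ∃ s ∈ S, ∃ s' ∈ S, ix s ≠ ix s' := by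
  by_contra! hcon
  have key : ∀ p : ZMod g, ∃ s ∈ S, edgeDist G s s(vc p, vc (p + 1)) ≠
      edgeDist G s s(vc p, vc (p - 1)) := fun p => by
    have h1 := R.labelling.2 (p - 1)
    rw [sub_add_cancel] at h1
    refine hS _ (R.labelling.2 p) _ h1.symm fun hc => ?_
    rw [Sym2.congr_right] at hc
    exact add_one_ne_sub_one hg _ (R.labelling.1 hc)
  obtain ⟨s₀, hs₀, -⟩ := key 0
  obtain ⟨s, hs, hd⟩ := key (ix s₀)
  rw [edgeDist_mk, edgeDist_mk, R.dist_vc hg, R.dist_vc hg, R.dist_vc hg, hcon s hs s₀ hs₀,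
    cycDist_self_add_one hg, cycDist_self_sub_one hg] at hd
  exact hd rfl

end

variable {V : Type*} [Fintype V] [DecidableEq V] {G : SimpleGraph V} [DecidableRel G.Adj] {g : ℕ}
  {vc : ZMod g → V} {par : V → V} {h : V → ℕ} {ix : V → ZMod g}

/-- The first vertices of two threads at the same vertex that avoid `S` are equidistant from `S`. -/
theorem dist_head_eq (R : CycleRooting G g vc par h ix) {S : Set V} {v u : V} {t : List V}
    (hu : u ∈ children par h v) (hd : Descends G par h u t) (hS : ∀ s ∈ S, s ∉ u :: t) {s : V}
    (hs : s ∈ S) : G.dist s u = G.dist s v + 1 := by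
  obtain ⟨rfl, h1⟩ := mem_children.1 hu
  refine R.dist_eq_dist_par_add_one h1 fun hb => hS s hs ?_
  rwa [R.mem_iff_below_of_descends h1 hd]

theorem branchResolving_of_exists (R : CycleRooting G g vc par h ix) (hg : 3 ≤ g) {S : Set V}
    (hS : ∀ v u u', G.Adj u v → G.Adj u' v → u ≠ u' →
      ¬ ∀ s ∈ S, G.dist s u = G.dist s v + 1 ∧ G.dist s u' = G.dist s v + 1) :
    BranchResolving G S := by
  intro v t₁ t₂ ht₁ ht₂ hne
  by_contra! hcon
  obtain ⟨u₁, t₁, rfl, h1, d1⟩ := R.exists_descends_of_isThreadAt hg ht₁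
  obtain ⟨u₂, t₂, rfl, h2, d2⟩ := R.exists_descends_of_isThreadAt hg ht₂
  obtain ⟨e1, e1'⟩ := mem_children.1 h1
  obtain ⟨e2, e2'⟩ := mem_children.1 h2
  refine hS v u₁ u₂ (e1 ▸ R.adj_par _ e1') (e2 ▸ R.adj_par _ e2') ?_ fun s hs =>
    ⟨R.dist_head_eq h1 d1 hcon.1 hs, R.dist_head_eq h2 d2 hcon.2 hs⟩
  rintro rfl
  exact hne (R.thread_unique hg ht₁ ht₂ List.mem_cons_self List.mem_cons_self).2

theorem branchResolving_of_isVertexMG (R : CycleRooting G g vc par h ix) (hg : 3 ≤ g) {S : Set V}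
    (hS : IsVertexMG G S) : BranchResolving G S := by
  refine R.branchResolving_of_exists hg fun v u u' _ _ hne hcon => ?_
  obtain ⟨s, hs, hd⟩ := hS u u' hne
  exact hd ((hcon s hs).1.trans (hcon s hs).2.symm)

theorem branchResolving_of_isEdgeMG (R : CycleRooting G g vc par h ix) (hg : 3 ≤ g) {S : Set V}
    (hS : IsEdgeMG G S) : BranchResolving G S := by
  refine R.branchResolving_of_exists hg fun v u u' hu hu' hne hcon => ?_
  obtain ⟨s, hs, hd⟩ := hS s(u, v) hu s(u', v) hu' fun hc => hne (Sym2.congr_left.1 hc)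
  rw [edgeDist_mk, edgeDist_mk, (hcon s hs).1, (hcon s hs).2] at hd
  exact hd rfl

end CycleRooting

/-! ### Sufficient conditions for metric generators -/

/-- Some three trees meeting `S` have roots that no half of the cycle contains. -/
def TripleActive {V : Type*} {g : ℕ} (ix : V → ZMod g) (S : Set V) : Prop :=
  ∃ x y z, NatTriple g x y z ∧ ∀ a, a = x ∨ a = y ∨ a = z → ∃ s ∈ S, (ix s).val = a

/-- `f` is the distance function of an object of the tree at `v_p`, at height `H`. -/
def TreeDist {V : Type*} {g : ℕ} (h : V → ℕ) (ix : V → ZMod g) (f : V → ℕ) (p : ZMod g)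
    (H : ℕ) : Prop :=
  ∀ s, f s ≤ h s + cycDist (ix s) p + H ∧ (ix s ≠ p → f s = h s + cycDist (ix s) p + H)

theorem natDist_val {g : ℕ} (p q : ZMod g) : natDist g p.val q.val = cycDist p q := rfl

theorem TreeDist.unique {V : Type*} {g : ℕ} (hg : 3 ≤ g) {h : V → ℕ} {ix : V → ZMod g}
    {S : Set V} (hS : TripleActive ix S) {f f' : V → ℕ} {p q : ZMod g} {H K : ℕ}
    (hf : TreeDist h ix f p H) (hf' : TreeDist h ix f' q K) (heq : ∀ s ∈ S, f s = f' s) :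
    p = q ∧ H = K := by
  have : NeZero g := ⟨by omega⟩
  obtain ⟨x, y, z, ht, hact⟩ := hS
  have hpq : p = q := by
    by_contra hne
    refine ht.tree_tree (ZMod.val_lt p) (ZMod.val_lt q) (fun hc => hne (ZMod.val_injective g hc))
      (H := H) (K := K) fun a ha => ?_
    obtain ⟨s, hs, rfl⟩ := hact a ha
    have h1 := hf s
    have h2 := hf' s
    have h3 := heq s hs
    rw [natDist_val, natDist_val]
    constructor
    · intro hn
      have := h2.2 fun hc => hn (by rw [hc])
      omega
    · intro hn
      have := h1.2 fun hc => hn (by rw [hc])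
      omega
  subst hpq
  refine ⟨rfl, ?_⟩
  obtain ⟨a, ha, hap⟩ : ∃ a, (a = x ∨ a = y ∨ a = z) ∧ a ≠ p.val := by
    have : x < y := ht.1
    by_cases hx : x = p.val
    · exact ⟨y, by simp, by omega⟩
    · exact ⟨x, by simp, hx⟩
  obtain ⟨s, hs, rfl⟩ := hact a ha
  have hn : ix s ≠ p := fun hc => hap (by rw [hc])
  have h1 := (hf s).2 hn
  have h2 := (hf' s).2 hn
  have h3 := heq s hs
  omega

namespace CycleRooting

section

variable {V : Type*} {G : SimpleGraph V} {g : ℕ} {vc : ZMod g → V} {par : V → V} {h : V → ℕ}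
  {ix : V → ZMod g}

theorem treeDist_vertex (R : CycleRooting G g vc par h ix) (hg : 3 ≤ g) (u : V) :
    TreeDist h ix (fun s => G.dist s u) (ix u) (h u) :=
  fun s => ⟨R.dist_le_add hg s u, fun hs => R.dist_eq_add hg hs⟩

theorem treeDist_edge (R : CycleRooting G g vc par h ix) (hg : 3 ≤ g) {x : V} (hx : 0 < h x) :
    TreeDist h ix (fun s => edgeDist G s s(x, par x)) (ix x) (h (par x)) := by
  intro s
  have h1 := R.treeDist_vertex hg x s
  have h2 := R.treeDist_vertex hg (par x) s
  have h3 := R.h_par x hx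
  rw [R.ix_par] at h2
  simp only [edgeDist_mk] at h1 h2 ⊢
  refine ⟨by omega, fun hs => ?_⟩
  have h4 := h1.2 hs
  have h5 := h2.2 hs
  omega

theorem edgeDist_cycle (R : CycleRooting G g vc par h ix) (hg : 3 ≤ g) (s : V) (i : ZMod g) :
    edgeDist G s s(vc i, vc (i + 1)) = h s + min (cycDist (ix s) i) (cycDist (ix s) (i + 1)) := by
  rw [edgeDist_mk, R.dist_vc hg, R.dist_vc hg]
  omega

theorem edge_cases (R : CycleRooting G g vc par h ix) {e : Sym2 V} (he : e ∈ G.edgeSet) :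
    (∃ x, 0 < h x ∧ e = s(x, par x)) ∨ ∃ i, e = s(vc i, vc (i + 1)) := by
  induction e using Sym2.ind with
  | _ x y =>
    rcases R.adj_cases x y he with ⟨h1, rfl⟩ | ⟨h1, rfl⟩ | ⟨h1, h2, h3 | h3⟩
    · exact Or.inl ⟨x, h1, rfl⟩
    · exact Or.inl ⟨y, h1, Sym2.eq_swap⟩
    · exact Or.inr ⟨ix x, by rw [← h3, R.vc_ix x h1, R.vc_ix y h2]⟩
    · exact Or.inr ⟨ix y, by rw [← h3, R.vc_ix x h1, R.vc_ix y h2, Sym2.eq_swap]⟩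

theorem treeDist_edge_ne_cycle (R : CycleRooting G g vc par h ix) (hg : 3 ≤ g) {S : Set V}
    (hS : TripleActive ix S) {f : V → ℕ} {p : ZMod g} {H : ℕ} (hf : TreeDist h ix f p H)
    (i : ZMod g) : ∃ s ∈ S, f s ≠ edgeDist G s s(vc i, vc (i + 1)) := by
  have : NeZero g := ⟨by omega⟩
  by_contra! hcon
  obtain ⟨x, y, z, ht, hact⟩ := hS
  have hi := ZMod.val_lt i
  refine ht.tree_cycle (ZMod.val_lt p) hi (r := (i + 1).val) (H := H) ?_ fun a ha hap => ?_
  · have := val_add_one_cases hg i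
    omega
  · obtain ⟨s, hs, rfl⟩ := hact a ha
    have h1 := (hf s).2 fun hc => hap (by rw [hc])
    have h2 := hcon s hs
    rw [R.edgeDist_cycle hg] at h2
    rw [natDist_val, natDist_val, natDist_val]
    omega

theorem cycle_edge_unique (R : CycleRooting G g vc par h ix) (hg : 3 ≤ g) {S : Set V}
    (hS : TripleActive ix S) {i j : ZMod g}
    (heq : ∀ s ∈ S, edgeDist G s s(vc i, vc (i + 1)) = edgeDist G s s(vc j, vc (j + 1))) :
    i = j := by
  have : NeZero g := ⟨by omega⟩
  obtain ⟨x, y, z, ht, hact⟩ := hS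
  have hi := ZMod.val_lt i
  have hj := ZMod.val_lt j
  refine ZMod.val_injective g (ht.cycle_cycle hi hj (r := (i + 1).val) (s := (j + 1).val) ?_ ?_
    fun a ha => ?_)
  · have := val_add_one_cases hg i
    omega
  · have := val_add_one_cases hg j
    omega
  · obtain ⟨s, hs, rfl⟩ := hact a ha
    have h2 := heq s hs
    rw [R.edgeDist_cycle hg, R.edgeDist_cycle hg] at h2
    simp only [natDist_val]
    omega

end

variable {V : Type*} [Fintype V] [DecidableEq V] {G : SimpleGraph V} {g : ℕ}
  {vc : ZMod g → V} {par : V → V} {h : V → ℕ} {ix : V → ZMod g}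

/-- Two vertices of the same tree at the same height lie below different children of a vertex. -/
theorem exists_children_below (R : CycleRooting G g vc par h ix) {u v : V} (huv : u ≠ v)
    (hh : h u = h v) (hi : ix u = ix v) : ∃ w, ∃ w₁ ∈ children par h w, ∃ w₂ ∈ children par h w,
      w₁ ≠ w₂ ∧ Below par w₁ u ∧ Below par w₂ v := by
  suffices ∀ n u v, h u = n → u ≠ v → h u = h v → ix u = ix v → ∃ w, ∃ w₁ ∈ children par h w,
      ∃ w₂ ∈ children par h w, w₁ ≠ w₂ ∧ Below par w₁ u ∧ Below par w₂ v from
    this _ u v rfl huv hh hi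
  intro n
  induction n with
  | zero =>
    intro u v h0 hne hh hi
    refine absurd ?_ hne
    rw [← R.vc_ix u h0, ← R.vc_ix v (hh ▸ h0), hi]
  | succ n ih =>
    intro u v h0 hne hh hi
    have hu : 0 < h u := by omega
    have hv : 0 < h v := by omega
    by_cases hp : par u = par v
    · exact ⟨par u, u, mem_children.2 ⟨rfl, hu⟩, v, mem_children.2 ⟨hp.symm, hv⟩, hne,
        below_refl _, below_refl _⟩
    · have h1 := R.h_par u hu
      have h2 := R.h_par v hv
      obtain ⟨w, w₁, hw₁, w₂, hw₂, h3, h4, h5⟩ := ih (par u) (par v) (by omega) hp (by omega)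
        (by rw [R.ix_par, R.ix_par, hi])
      exact ⟨w, w₁, hw₁, w₂, hw₂, h3, below_par h4, below_par h5⟩

/-- A vertex below `w₁` is closer to vertices below `w₁` than to those below a sibling. -/
theorem dist_add_two_le (R : CycleRooting G g vc par h ix) {w w₁ w₂ s u v : V}
    (hw₁ : w₁ ∈ children par h w) (hw₂ : w₂ ∈ children par h w) (hne : w₁ ≠ w₂)
    (hs : Below par w₁ s) (hu : Below par w₁ u) (hv : Below par w₂ v) (hh : h u = h v) :
    G.dist s u + 2 ≤ G.dist s v := by
  obtain ⟨e1, p1⟩ := mem_children.1 hw₁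
  obtain ⟨e2, p2⟩ := mem_children.1 hw₂
  have k1 := R.h_par w₁ p1
  have k2 := R.h_par w₂ p2
  rw [e1] at k1
  rw [e2] at k2
  have hnb : ¬ Below par w₁ v := fun hb => by
    rcases below_total hb hv with hc | hc
    · exact hne (R.eq_of_below_of_h_eq hc (by omega)).symm
    · exact hne (R.eq_of_below_of_h_eq hc (by omega))
  have h1 := R.dist_eq_of_cut p1 hs hnb
  rw [e1] at h1
  have h2 := R.conn.dist_triangle (u := s) (v := w₁) (w := u)
  have h3 := R.dist_of_below hu
  have h4 : Below par w v := below_trans ⟨1, e2⟩ hv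
  have h5 := R.dist_of_below h4
  omega

variable [DecidableRel G.Adj]

/-- A branch-resolving set has members much closer to one than to the other of two vertices of the
same tree at the same height. -/
theorem exists_dist_add_two_le (R : CycleRooting G g vc par h ix) (hg : 3 ≤ g) {S : Set V}
    (hS : BranchResolving G S) {u v : V} (huv : u ≠ v) (hh : h u = h v) (hi : ix u = ix v) :
    ∃ s ∈ S, G.dist s u + 2 ≤ G.dist s v ∨ G.dist s v + 2 ≤ G.dist s u := by
  obtain ⟨w, w₁, hw₁, w₂, hw₂, hne, hu, hv⟩ := R.exists_children_below huv hh hi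
  obtain ⟨s, hs, hb | hb⟩ := R.exists_below_of_branchResolving hg hS hw₁ hw₂ hne
  · exact ⟨s, hs, Or.inl (R.dist_add_two_le hw₁ hw₂ hne hb hu hv hh)⟩
  · exact ⟨s, hs, Or.inr (R.dist_add_two_le hw₂ hw₁ hne.symm hb hv hu hh.symm)⟩

theorem isVertexMG_of_tripleActive (R : CycleRooting G g vc par h ix) (hg : 3 ≤ g) {S : Set V}
    (hS : BranchResolving G S) (hact : TripleActive ix S) : IsVertexMG G S := by
  intro u v huv
  by_contra! hcon
  obtain ⟨h1, h2⟩ := TreeDist.unique hg hact (R.treeDist_vertex hg u) (R.treeDist_vertex hg v) hcon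
  obtain ⟨s, hs, hd⟩ := R.exists_dist_add_two_le hg hS huv h2 h1
  have := hcon s hs
  omega

theorem isEdgeMG_of_tripleActive (R : CycleRooting G g vc par h ix) (hg : 3 ≤ g) {S : Set V}
    (hS : BranchResolving G S) (hact : TripleActive ix S) : IsEdgeMG G S := by
  intro e he f hf hef
  rcases R.edge_cases he with ⟨x, hx, rfl⟩ | ⟨i, rfl⟩ <;>
    rcases R.edge_cases hf with ⟨y, hy, rfl⟩ | ⟨j, rfl⟩
  · by_contra! hcon
    obtain ⟨h1, h2⟩ := TreeDist.unique hg hact (R.treeDist_edge hg hx) (R.treeDist_edge hg hy) hcon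
    have hxy : x ≠ y := by
      rintro rfl
      exact hef rfl
    have h3 := R.h_par x hx
    have h4 := R.h_par y hy
    obtain ⟨s, hs, hd⟩ := R.exists_dist_add_two_le hg hS hxy (by omega) h1
    have h5 := hcon s hs
    have h6 := R.conn.dist_triangle (u := s) (v := par x) (w := x)
    have h7 := R.conn.dist_triangle (u := s) (v := par y) (w := y)
    rw [SimpleGraph.dist_eq_one_iff_adj.2 (R.adj_par _ hx).symm] at h6
    rw [SimpleGraph.dist_eq_one_iff_adj.2 (R.adj_par _ hy).symm] at h7
    rw [edgeDist_mk, edgeDist_mk] at h5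
    omega
  · exact R.treeDist_edge_ne_cycle hg hact (R.treeDist_edge hg hx) j
  · obtain ⟨s, hs, hd⟩ := R.treeDist_edge_ne_cycle hg hact (R.treeDist_edge hg hy) i
    exact ⟨s, hs, hd.symm⟩
  · by_contra! hcon
    obtain rfl := R.cycle_edge_unique hg hact hcon
    exact hef rfl

end CycleRooting

/-! ### Counting -/

theorem finite_setOf_isThreadAt {V : Type*} [Fintype V] [DecidableEq V] (G : SimpleGraph V)
    [DecidableRel G.Adj] (v : V) : {t : List V | IsThreadAt G v t}.Finite :=
  (Set.finite_coe_iff.1 (inferInstanceAs (Finite {t : List V // t.Nodup}))).subset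
    fun _ ht => ht.2.1

/-- The finite set of threads hanging at `v`. -/
noncomputable def threads {V : Type*} [Fintype V] [DecidableEq V] (G : SimpleGraph V)
    [DecidableRel G.Adj] (v : V) : Finset (List V) :=
  (finite_setOf_isThreadAt G v).toFinset

theorem mem_threads {V : Type*} [Fintype V] [DecidableEq V] {G : SimpleGraph V}
    [DecidableRel G.Adj] {v : V} {t : List V} : t ∈ threads G v ↔ IsThreadAt G v t := by
  simp [threads]

theorem numThreads_eq_card {V : Type*} [Fintype V] [DecidableEq V] (G : SimpleGraph V)
    [DecidableRel G.Adj] (v : V) : numThreads G v = (threads G v).card :=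
  Set.ncard_eq_toFinset_card _ _

namespace CycleRooting

variable {V : Type*} [Fintype V] [DecidableEq V] {G : SimpleGraph V} [DecidableRel G.Adj] {g : ℕ}
  {vc : ZMod g → V} {par : V → V} {h : V → ℕ} {ix : V → ZMod g}

theorem numThreads_le_card_children (R : CycleRooting G g vc par h ix) (hg : 3 ≤ g) (v : V) :
    numThreads G v ≤ (children par h v).card := by
  rw [numThreads_eq_card]
  refine Finset.card_le_card_of_forall_subsingleton (fun t u => u ∈ t) (fun t ht => ?_)
    fun u _ t ht t' ht' => ?_
  · obtain ⟨u, t', rfl, hu, -⟩ := R.exists_descends_of_isThreadAt hg (mem_threads.1 ht)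
    exact ⟨u, hu, List.mem_cons_self⟩
  · exact (R.thread_unique hg (mem_threads.1 ht.1) (mem_threads.1 ht'.1) ht.2 ht'.2).2

theorem branching_iff (R : CycleRooting G g vc par h ix) (hg : 3 ≤ g) (x : V) :
    Branching G g vc x ↔ 2 ≤ (children par h x).card := by
  unfold Branching
  rcases Nat.eq_zero_or_pos (h x) with h0 | h0
  · have h1 : x ∈ Set.range vc := ⟨ix x, R.vc_ix x h0⟩
    have h2 := R.degree_of_zero hg h0
    simp only [h1, not_true_eq_false, false_and, true_and, false_or]
    omega
  · have h1 : x ∉ Set.range vc := by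
      rintro ⟨i, rfl⟩
      simp [R.h_vc] at h0
    have h2 := R.degree_of_pos h0
    simp only [h1, not_false_eq_true, false_and, true_and, or_false]
    omega

theorem branchActive_iff (R : CycleRooting G g vc par h ix) (hg : 3 ≤ g) (i : ZMod g) :
    BranchActive G g vc i ↔ ∃ x, ix x = i ∧ 2 ≤ (children par h x).card := by
  unfold BranchActive
  simp only [R.inTree_iff, R.branching_iff hg]

open Classical in
theorem numThreads_sub_one_le_card (R : CycleRooting G g vc par h ix) (hg : 3 ≤ g) {S : Finset V}
    (hS : BranchResolving G S) (v : V) :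
    numThreads G v - 1 ≤ (S.filter fun s => ∃ t, IsThreadAt G v t ∧ s ∈ t).card := by
  rw [numThreads_eq_card]
  have h1 : ((threads G v).filter fun t => ¬ ∃ s ∈ S, s ∈ t).card ≤ 1 := by
    rw [Finset.card_le_one]
    intro t ht t' ht'
    rw [Finset.mem_filter, mem_threads] at ht ht'
    by_contra hne
    rcases hS v t t' ht.1 ht'.1 hne with hc | hc
    · exact ht.2 hc
    · exact ht'.2 hc
  have h2 : ((threads G v).filter fun t => ∃ s ∈ S, s ∈ t).card ≤
      (S.filter fun s => ∃ t, IsThreadAt G v t ∧ s ∈ t).card := by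
    refine Finset.card_le_card_of_forall_subsingleton (fun t s => s ∈ t) (fun t ht => ?_)
      fun s _ t ht t' ht' => ?_
    · rw [Finset.mem_filter, mem_threads] at ht
      obtain ⟨ht, s, hs, hst⟩ := ht
      exact ⟨s, Finset.mem_filter.2 ⟨hs, t, ht, hst⟩, hst⟩
    · have e1 := mem_threads.1 (Finset.mem_filter.1 ht.1).1
      have e2 := mem_threads.1 (Finset.mem_filter.1 ht'.1).1
      exact (R.thread_unique hg e1 e2 ht.2 ht'.2).2
  have h3 := Finset.card_filter_add_card_filter_not (s := threads G v) fun t => ∃ s ∈ S, s ∈ t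
  omega

open Classical in
/-- Members of a branch-resolving set on threads that compete with another thread. -/
theorem LG_le_card (R : CycleRooting G g vc par h ix) (hg : 3 ≤ g) {S : Finset V}
    (hS : BranchResolving G S) :
    LG G ≤ (S.filter fun s => ∃ v t, IsThreadAt G v t ∧ s ∈ t ∧ 2 ≤ numThreads G v).card := by
  have h1 : ∀ v, numThreads G v - 1 ≤
      (S.filter fun s => ∃ t, IsThreadAt G v t ∧ s ∈ t ∧ 2 ≤ numThreads G v).card := by
    intro v
    by_cases hv : 2 ≤ numThreads G v
    · simpa [hv] using R.numThreads_sub_one_le_card hg hS v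
    · omega
  refine (Finset.sum_le_sum fun v _ => h1 v).trans ?_
  rw [← Finset.card_biUnion]
  · refine Finset.card_le_card fun s hs => ?_
    simp only [Finset.mem_biUnion, Finset.mem_filter, Finset.mem_univ, true_and] at hs ⊢
    obtain ⟨v, hsS, t, ht⟩ := hs
    exact ⟨hsS, v, t, ht⟩
  · intro v _ v' _ hne
    refine Finset.disjoint_left.2 ?_
    intro s hs hs'
    obtain ⟨-, t, ht, hst, -⟩ := Finset.mem_filter.1 hs
    obtain ⟨-, t', ht', hst', -⟩ := Finset.mem_filter.1 hs'
    exact hne (R.thread_unique hg ht ht' hst hst').1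

theorem LG_add_le_card (R : CycleRooting G g vc par h ix) (hg : 3 ≤ g) {S : Finset V}
    (hS : BranchResolving G S) (hix : ∃ s ∈ S, ∃ s' ∈ S, ix s ≠ ix s') :
    LG G + (2 - bG G g vc) ≤ S.card := by
  classical
  have : NeZero g := ⟨by omega⟩
  set P : V → Prop := fun s => ∃ v t, IsThreadAt G v t ∧ s ∈ t ∧ 2 ≤ numThreads G v with hP
  have h1 : LG G ≤ (S.filter P).card := R.LG_le_card hg hS
  have h2 := Finset.card_filter_add_card_filter_not (s := S) P
  have h3 : bG G g vc = (Finset.univ.filter fun i => BranchActive G g vc i).card := by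
    rw [bG, Set.ncard_eq_toFinset_card', Set.toFinset_ofPred]
  have h4 : ∀ s, P s → BranchActive G g vc (ix s) := by
    rintro s ⟨v, t, ht, hst, hv⟩
    refine (R.branchActive_iff hg _).2 ⟨v, ?_, hv.trans (R.numThreads_le_card_children hg v)⟩
    obtain ⟨u, t', rfl, hu, hd⟩ := R.exists_descends_of_isThreadAt hg ht
    obtain ⟨e1, e2⟩ := mem_children.1 hu
    rw [R.mem_iff_below_of_descends e2 hd] at hst
    rw [R.ix_of_below hst, ← R.ix_par u, e1]
  have h5 : S.image ix ⊆ (S.filter fun s => ¬ P s).image ix ∪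
      Finset.univ.filter fun i => BranchActive G g vc i := by
    intro i hi
    obtain ⟨s, hs, rfl⟩ := Finset.mem_image.1 hi
    by_cases hps : P s
    · exact Finset.mem_union_right _ (Finset.mem_filter.2 ⟨Finset.mem_univ _, h4 s hps⟩)
    · exact Finset.mem_union_left _ (Finset.mem_image_of_mem _ (Finset.mem_filter.2 ⟨hs, hps⟩))
  have h6 : 1 < (S.image ix).card := by
    obtain ⟨s, hs, s', hs', hne⟩ := hix
    exact Finset.one_lt_card.2
      ⟨_, Finset.mem_image_of_mem _ hs, _, Finset.mem_image_of_mem _ hs', hne⟩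
  have h7 := (Finset.card_le_card h5).trans (Finset.card_union_le _ _)
  have h8 : ((S.filter fun s => ¬ P s).image ix).card ≤ (S.filter fun s => ¬ P s).card :=
    Finset.card_image_le
  omega

end CycleRooting

theorem exists_card_le_hit_threads {V : Type*} [Fintype V] [DecidableEq V] (G : SimpleGraph V)
    [DecidableRel G.Adj] (v : V) : ∃ H : Finset V, H.card ≤ numThreads G v - 1 ∧
      ∀ t t', IsThreadAt G v t → IsThreadAt G v t' → t ≠ t' →
        (∃ s ∈ H, s ∈ t) ∨ (∃ s ∈ H, s ∈ t') := by
  rw [numThreads_eq_card]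
  rcases (threads G v).eq_empty_or_nonempty with h0 | ⟨t₀, ht₀⟩
  · refine ⟨∅, by simp, fun t t' ht => ?_⟩
    rw [← mem_threads, h0] at ht
    simp at ht
  · refine ⟨((threads G v).erase t₀).image fun t => t.headD v, ?_, fun t t' ht ht' hne => ?_⟩
    · rw [← Finset.card_erase_of_mem ht₀]
      exact Finset.card_image_le
    · have key : ∀ t, IsThreadAt G v t → t ≠ t₀ →
          ∃ s ∈ ((threads G v).erase t₀).image fun t => t.headD v, s ∈ t := fun t ht hne => by
        refine ⟨t.headD v, Finset.mem_image_of_mem _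
          (Finset.mem_erase.2 ⟨hne, mem_threads.2 ht⟩), ?_⟩
        cases t with
        | nil => exact absurd rfl ht.1
        | cons u t => simp
      by_cases h1 : t = t₀
      · exact Or.inr (key t' ht' fun hc => hne (h1.trans hc.symm))
      · exact Or.inl (key t ht h1)

/-- A branch-resolving set of minimum size. -/
theorem exists_branchResolving {V : Type*} [Fintype V] [DecidableEq V] (G : SimpleGraph V)
    [DecidableRel G.Adj] : ∃ S : Finset V, BranchResolving G S ∧ S.card ≤ LG G := by
  choose H hc hH using exists_card_le_hit_threads G
  refine ⟨Finset.univ.biUnion H, fun v t t' ht ht' hne => ?_,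
    Finset.card_biUnion_le.trans (Finset.sum_le_sum fun v _ => hc v)⟩
  have hsub : ∀ s ∈ H v, s ∈ ((Finset.univ.biUnion H : Finset V) : Set V) := fun s hs =>
    Finset.mem_coe.2 (Finset.mem_biUnion.2 ⟨v, Finset.mem_univ v, hs⟩)
  rcases hH v t t' ht ht' hne with ⟨s, hs, hst⟩ | ⟨s, hs, hst⟩
  · exact Or.inl ⟨s, hsub s hs, hst⟩
  · exact Or.inr ⟨s, hsub s hs, hst⟩

/-- Few indices have to be added to `B` in order to obtain a triple contained in no half of the
cycle. -/
theorem exists_natTriple_of_finset {g : ℕ} (hg : 3 ≤ g) (B : Finset (ZMod g)) :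
    ∃ A : Finset (ZMod g), A.card ≤ 2 - B.card + 1 ∧ ∃ x y z, NatTriple g x y z ∧
      ∀ a, a = x ∨ a = y ∨ a = z → ∃ i ∈ B ∪ A, i.val = a := by
  have : NeZero g := ⟨by omega⟩
  obtain ⟨A, hA, hBA⟩ : ∃ A : Finset (ZMod g), A.card ≤ 2 - B.card ∧ 1 < (B ∪ A).card := by
    by_cases hb : B.card ≤ 2
    · obtain ⟨A, hBA, hA⟩ := Finset.exists_superset_card_eq hb (by rw [ZMod.card]; omega)
      refine ⟨A \ B, ?_, ?_⟩
      · rw [Finset.card_sdiff_of_subset hBA, hA]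
      · rw [Finset.union_sdiff_of_subset hBA, hA]
        norm_num
    · exact ⟨∅, by simp, by rw [Finset.union_empty]; omega⟩
  obtain ⟨p, hp, q, hq, hpq⟩ := Finset.one_lt_card.1 hBA
  wlog hlt : p.val < q.val generalizing p q
  · refine this q hq p hp hpq.symm ?_
    have : p.val ≠ q.val := fun hc => hpq (ZMod.val_injective g hc)
    omega
  obtain ⟨k, hk, hT⟩ := exists_natTriple hg hlt (ZMod.val_lt q)
  refine ⟨insert (k : ZMod g) A, (Finset.card_insert_le _ _).trans (by omega), ?_⟩
  have e : B ∪ insert (k : ZMod g) A = insert (k : ZMod g) (B ∪ A) := by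
    rw [Finset.union_insert]
  have hall : ∀ a, a = p.val ∨ a = q.val ∨ a = k →
      ∃ i ∈ B ∪ insert (k : ZMod g) A, i.val = a := by
    rw [e]
    rintro a (rfl | rfl | rfl)
    · exact ⟨p, Finset.mem_insert_of_mem hp, rfl⟩
    · exact ⟨q, Finset.mem_insert_of_mem hq, rfl⟩
    · exact ⟨_, Finset.mem_insert_self _ _, ZMod.val_cast_of_lt hk⟩
  rcases hT with hT | hT | hT
  · exact ⟨_, _, _, hT, fun a ha => hall a (by tauto)⟩
  · exact ⟨_, _, _, hT, fun a ha => hall a (by tauto)⟩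
  · exact ⟨_, _, _, hT, fun a ha => hall a (by tauto)⟩

theorem CycleRooting.exists_generator {V : Type*} [Fintype V] [DecidableEq V] {G : SimpleGraph V}
    [DecidableRel G.Adj] {g : ℕ} {vc : ZMod g → V} {par : V → V} {h : V → ℕ} {ix : V → ZMod g}
    (R : CycleRooting G g vc par h ix) (hg : 3 ≤ g) : ∃ S : Finset V,
      S.card ≤ LG G + (2 - bG G g vc) + 1 ∧ IsVertexMG G S ∧ IsEdgeMG G S := by
  classical
  have : NeZero g := ⟨by omega⟩
  obtain ⟨S, hS, hc⟩ := exists_branchResolving G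
  set B : Finset (ZMod g) := Finset.univ.filter fun i => BranchActive G g vc i with hB
  have h1 : bG G g vc = B.card := by
    rw [bG, Set.ncard_eq_toFinset_card', Set.toFinset_ofPred]
  obtain ⟨A, hA, x, y, z, hT, hxyz⟩ := exists_natTriple_of_finset hg B
  have hbr : BranchResolving G ((S ∪ A.image vc : Finset V) : Set V) := by
    intro v t t' ht ht' hne
    rcases hS v t t' ht ht' hne with ⟨s, hs, hst⟩ | ⟨s, hs, hst⟩
    · exact Or.inl ⟨s, Finset.mem_union_left _ hs, hst⟩
    · exact Or.inr ⟨s, Finset.mem_union_left _ hs, hst⟩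
  have hact : TripleActive ix ((S ∪ A.image vc : Finset V) : Set V) := by
    refine ⟨x, y, z, hT, fun a ha => ?_⟩
    obtain ⟨i, hi, rfl⟩ := hxyz a ha
    rcases Finset.mem_union.1 hi with hi | hi
    · obtain ⟨w, rfl, hw⟩ := (R.branchActive_iff hg _).1 (Finset.mem_filter.1 hi).2
      obtain ⟨w₁, hw₁, w₂, hw₂, hne⟩ := Finset.one_lt_card.1 hw
      obtain ⟨s, hs, hb⟩ := R.exists_below_of_branchResolving hg hS hw₁ hw₂ hne
      refine ⟨s, Finset.mem_union_left _ hs, ?_⟩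
      rcases hb with hb | hb
      · rw [R.ix_of_below hb, R.ix_of_below (below_of_mem_children hw₁)]
      · rw [R.ix_of_below hb, R.ix_of_below (below_of_mem_children hw₂)]
    · exact ⟨vc i, Finset.mem_union_right _ (Finset.mem_image_of_mem _ hi), by rw [R.ix_vc]⟩
  refine ⟨S ∪ A.image vc, ?_, R.isVertexMG_of_tripleActive hg hbr hact,
    R.isEdgeMG_of_tripleActive hg hbr hact⟩
  have h2 := Finset.card_union_le S (A.image vc)
  have h3 : (A.image vc).card ≤ A.card := Finset.card_image_le
  omega

theorem statement_16 {V : Type*} [Fintype V] [DecidableEq V] (G : SimpleGraph V)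
    [DecidableRel G.Adj] (hG : IsUnicyclic G) (g : ℕ) (hg : 3 ≤ g)
    (vc : ZMod g → V) (hvc : IsCycleLabelling G g vc) :
    LG G + max 0 (2 - bG G g vc) ≤ metricDim G ∧
    metricDim G ≤ LG G + max 0 (2 - bG G g vc) + 1 ∧
    LG G + max 0 (2 - bG G g vc) ≤ edgeMetricDim G ∧
    edgeMetricDim G ≤ LG G + max 0 (2 - bG G g vc) + 1 ∧
    |(metricDim G : ℤ) - edgeMetricDim G| ≤ 1 := by
  obtain ⟨par, h, ix, R⟩ := exists_cycleRooting hG hg hvc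
  rw [Nat.zero_max]
  obtain ⟨S, hc, hv, he⟩ := R.exists_generator hg
  have h1 : metricDim G ≤ S.card := Nat.sInf_le ⟨S, rfl, hv⟩
  have h2 : edgeMetricDim G ≤ S.card := Nat.sInf_le ⟨S, rfl, he⟩
  have h3 : LG G + (2 - bG G g vc) ≤ metricDim G := by
    obtain ⟨S', hc', hv'⟩ : metricDim G ∈ {n | ∃ S : Finset V, S.card = n ∧ IsVertexMG G ↑S} :=
      Nat.sInf_mem ⟨_, S, rfl, hv⟩
    rw [← hc']
    exact R.LG_add_le_card hg (R.branchResolving_of_isVertexMG hg hv')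
      (R.exists_ix_ne_of_isVertexMG hg hv')
  have h4 : LG G + (2 - bG G g vc) ≤ edgeMetricDim G := by
    obtain ⟨S', hc', he'⟩ : edgeMetricDim G ∈ {n | ∃ S : Finset V, S.card = n ∧ IsEdgeMG G ↑S} :=
      Nat.sInf_mem ⟨_, S, rfl, he⟩
    rw [← hc']
    exact R.LG_add_le_card hg (R.branchResolving_of_isEdgeMG hg he')
      (R.exists_ix_ne_of_isEdgeMG hg he')
  refine ⟨h3, by omega, h4, by omega, ?_⟩
  rw [abs_le]
  omega
end

section
/- For every odd integer n ≥ 7, the corona product graph C_n⊙K_1 satisfies dim(C_n⊙K_1) = 2 and edim(C_n⊙K_1) = 3; in particular dim(C_n⊙K_1) − edim(C_n⊙K_1) = −1. -/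
open SimpleGraph

variable {V : Type*}

/-- The corona product `C_n ⊙ K_1`: the cycle on `ZMod n` (the `inl` vertices) together
with one pendant leaf (`inr i`) attached to each cycle vertex (`inl i`). -/
def coronaCycleK1 (n : ℕ) : SimpleGraph (ZMod n ⊕ ZMod n) :=
  SimpleGraph.fromRel (fun x y =>
    (∃ i : ZMod n, x = Sum.inl i ∧ y = Sum.inl (i + 1)) ∨
    (∃ i : ZMod n, x = Sum.inl i ∧ y = Sum.inr i))

/-- A function vanishing only at `s`, growing by at most one along edges, and which can always be
decreased by one along some edge, is the distance from `s`. -/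
theorem SimpleGraph.dist_eq_of_descent {G : SimpleGraph V} {s : V} (f : V → ℕ)
    (hs : ∀ v, f v = 0 ↔ v = s) (hadj : ∀ u v, G.Adj u v → f v ≤ f u + 1)
    (hdesc : ∀ v, f v ≠ 0 → ∃ u, G.Adj u v ∧ f v = f u + 1) (v : V) : G.dist s v = f v := by
  have upper : ∀ d v, f v = d → ∃ p : G.Walk s v, p.length = d := by
    intro d
    induction d with
    | zero =>
      intro v hv
      obtain rfl := (hs v).1 hv
      exact ⟨Walk.nil, rfl⟩
    | succ d ih =>
      intro v hv
      obtain ⟨u, huv, hu⟩ := hdesc v (by omega)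
      obtain ⟨p, hp⟩ := ih u (by omega)
      exact ⟨p.concat huv, by simp [hp]⟩
  have lower : ∀ u w (p : G.Walk u w), f w ≤ f u + p.length := by
    intro u w p
    induction p with
    | nil => simp
    | cons h p ih =>
      have := hadj _ _ h
      simp only [Walk.length_cons]
      omega
  obtain ⟨p, hp⟩ := upper _ v rfl
  obtain ⟨q, hq⟩ := p.reachable.exists_walk_length_eq_dist
  have h1 := lower _ _ q
  have h2 := dist_le p
  have h3 := (hs s).2 rfl
  omega

section Cycle

variable {n : ℕ}

/-- The length of the shorter arc from `a` to `b` in the cycle on `ZMod n`. -/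
def cycleDist (a b : ZMod n) : ℕ := min (b - a).val (n - (b - a).val)

theorem ZMod.val_add_one_eq_ite (hn : 1 < n) (x : ZMod n) :
    (x + 1).val = if x.val + 1 = n then 0 else x.val + 1 := by
  have : NeZero n := ⟨by omega⟩
  have h1 : (1 : ZMod n).val = 1 := ZMod.val_one'' (by omega)
  have hx := x.val_lt
  split_ifs with h
  · rw [ZMod.val_add_of_le (by omega), h1]; omega
  · rw [ZMod.val_add_of_lt (by omega), h1]

theorem ZMod.val_sub_one_eq_ite (hn : 1 < n) (x : ZMod n) :
    (x - 1).val = if x.val = 0 then n - 1 else x.val - 1 := by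
  have : NeZero n := ⟨by omega⟩
  have h := ZMod.val_add_one_eq_ite hn (x - 1)
  have h1 := (x - 1).val_lt
  rw [sub_add_cancel] at h
  split_ifs at h ⊢ <;> omega

theorem cycleDist_eq_val [NeZero n] (a b : ZMod n) :
    cycleDist a b = min (b.val - a.val + (a.val - b.val))
      (n - (b.val - a.val + (a.val - b.val))) := by
  have hb : b - a + a = b := sub_add_cancel b a
  have h1 := (b - a).val_lt
  have h2 := a.val_lt
  have h3 := b.val_lt
  unfold cycleDist
  rcases lt_or_ge ((b - a).val + a.val) n with h | h
  · have := ZMod.val_add_of_lt h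
    rw [hb] at this
    omega
  · have := ZMod.val_add_of_le h
    rw [hb] at this
    omega

theorem cycleDist_eq_zero_iff [NeZero n] (a b : ZMod n) : cycleDist a b = 0 ↔ b = a := by
  have h := (b - a).val_lt
  rw [← sub_eq_zero (a := b), ← ZMod.val_eq_zero]
  unfold cycleDist
  omega

theorem cycleDist_add_one (hn : 1 < n) (a i : ZMod n) :
    cycleDist a (i + 1) ≤ cycleDist a i + 1 ∧ cycleDist a i ≤ cycleDist a (i + 1) + 1 := by
  have : NeZero n := ⟨by omega⟩
  have h := ZMod.val_add_one_eq_ite hn (i - a)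
  have h1 := (i - a).val_lt
  unfold cycleDist
  rw [show i + 1 - a = i - a + 1 by ring]
  split_ifs at h <;> omega

theorem exists_cycleDist_descent (hn : 1 < n) (a i : ZMod n) (hi : cycleDist a i ≠ 0) :
    cycleDist a i = cycleDist a (i + 1) + 1 ∨ cycleDist a i = cycleDist a (i - 1) + 1 := by
  have : NeZero n := ⟨by omega⟩
  have h := ZMod.val_add_one_eq_ite hn (i - a)
  have h' := ZMod.val_sub_one_eq_ite hn (i - a)
  have h1 := (i - a).val_lt
  unfold cycleDist at *
  rw [show i + 1 - a = i - a + 1 by ring, show i - 1 - a = i - a - 1 by ring]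
  split_ifs at h h' <;> omega

/-- On an odd cycle, for any two vertices `a`, `b` some other vertex `i` is at the same distances
from `a` and `b` as some edge of the cycle. -/
theorem exists_cycleDist_eq_edge {k : ℕ} (hk : 2 ≤ k) (hn : n = 2 * k + 1) (a b : ZMod n) :
    ∃ i j, i ≠ a ∧ i ≠ b ∧
      cycleDist a i = min (cycleDist a j) (cycleDist a (j + 1)) ∧
      cycleDist b i = min (cycleDist b j) (cycleDist b (j + 1)) := by
  have : NeZero n := ⟨by omega⟩
  wlog hab : (b - a).val ≤ k generalizing a b
  · have hba : (a - b).val ≤ k := by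
      have h := ZMod.neg_val (b - a)
      rw [neg_sub] at h
      split_ifs at h <;> omega
    obtain ⟨i, j, h1, h2, h3, h4⟩ := this b a hba
    exact ⟨i, j, h2, h1, h4, h3⟩
  have h1n : 1 < n := by omega
  have e0 : ZMod.val (0 : ZMod n) = 0 := ZMod.val_zero
  have e1 := ZMod.val_add_one_eq_ite h1n (0 : ZMod n)
  have e2 := ZMod.val_add_one_eq_ite h1n (0 + 1 : ZMod n)
  have e3 := ZMod.val_sub_one_eq_ite h1n (0 : ZMod n)
  have f1 := ZMod.val_add_one_eq_ite h1n (b - a)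
  have f2 := ZMod.val_add_one_eq_ite h1n (b - a + 1)
  have f3 := ZMod.val_sub_one_eq_ite h1n (b - a)
  simp only [ne_eq, ← cycleDist_eq_zero_iff]
  unfold cycleDist
  rcases hab.lt_or_eq with hlt | heq
  · refine ⟨b + 1, b + 1, ?_⟩
    rw [show b + 1 - a = b - a + 1 by ring, show b + 1 + 1 - a = b - a + 1 + 1 by ring,
      show b + 1 - b = 0 + 1 by ring, show b + 1 + 1 - b = 0 + 1 + 1 by ring]
    rw [if_neg (by omega)] at e1 f1
    rw [if_neg (by omega)] at e2 f2
    refine ⟨?_, ?_, ?_, ?_⟩ <;> omega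
  · refine ⟨b - 1, b + 1, ?_⟩
    rw [show b + 1 - a = b - a + 1 by ring, show b + 1 + 1 - a = b - a + 1 + 1 by ring,
      show b + 1 - b = 0 + 1 by ring, show b + 1 + 1 - b = 0 + 1 + 1 by ring,
      show b - 1 - a = b - a - 1 by ring, show b - 1 - b = 0 - 1 by ring]
    rw [if_neg (by omega)] at e1 f1
    rw [if_neg (by omega)] at e2 f2
    rw [if_pos (by omega)] at e3
    rw [if_neg (by omega)] at f3
    refine ⟨?_, ?_, ?_, ?_⟩ <;> omega

theorem cycleDist_vertex_cases {k : ℕ} (hn : n = 2 * k + 1) (i : ZMod n) :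
    i.val ≤ k ∧ cycleDist 0 i = i.val ∧ cycleDist (k : ZMod n) i = k - i.val ∧
        cycleDist ((2 * k : ℕ) : ZMod n) i = min k (i.val + 1) ∨
      k < i.val ∧ cycleDist 0 i = 2 * k + 1 - i.val ∧ cycleDist (k : ZMod n) i = i.val - k ∧
        cycleDist ((2 * k : ℕ) : ZMod n) i = 2 * k - i.val := by
  have : NeZero n := ⟨by omega⟩
  have hi := i.val_lt
  rw [cycleDist_eq_val, cycleDist_eq_val, cycleDist_eq_val, ZMod.val_zero,
    ZMod.val_cast_of_lt (show k < n by omega), ZMod.val_cast_of_lt (show 2 * k < n by omega)]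
  rcases le_or_gt i.val k with h | h
  · exact Or.inl ⟨h, by omega, by omega, by omega⟩
  · exact Or.inr ⟨h, by omega, by omega, by omega⟩

theorem cycleDist_edge_cases {k : ℕ} (hk : 1 ≤ k) (hn : n = 2 * k + 1) (i : ZMod n) :
    i.val < k ∧ min (cycleDist 0 i) (cycleDist 0 (i + 1)) = i.val ∧
        min (cycleDist (k : ZMod n) i) (cycleDist (k : ZMod n) (i + 1)) = k - 1 - i.val ∧
        min (cycleDist ((2 * k : ℕ) : ZMod n) i) (cycleDist ((2 * k : ℕ) : ZMod n) (i + 1)) =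
          i.val + 1 ∨
      k ≤ i.val ∧ i.val < n ∧ min (cycleDist 0 i) (cycleDist 0 (i + 1)) = 2 * k - i.val ∧
        min (cycleDist (k : ZMod n) i) (cycleDist (k : ZMod n) (i + 1)) = i.val - k ∧
        min (cycleDist ((2 * k : ℕ) : ZMod n) i) (cycleDist ((2 * k : ℕ) : ZMod n) (i + 1)) =
          2 * k - 1 - i.val := by
  have : NeZero n := ⟨by omega⟩
  have hi := i.val_lt
  have hi' := ZMod.val_add_one_eq_ite (by omega) i
  have c1 := cycleDist_vertex_cases hn i
  have c2 := cycleDist_vertex_cases hn (i + 1)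
  split_ifs at hi' with h <;> omega

end Cycle

namespace coronaCycleK1

variable {n : ℕ}

theorem adj_inl_inl_add_one (hn : 1 < n) (i : ZMod n) :
    (coronaCycleK1 n).Adj (Sum.inl i) (Sum.inl (i + 1)) := by
  have : Fact (1 < n) := ⟨hn⟩
  refine (SimpleGraph.fromRel_adj _ _ _).2 ⟨?_, Or.inl (Or.inl ⟨i, rfl, rfl⟩)⟩
  simp

theorem adj_inl_inr (i : ZMod n) : (coronaCycleK1 n).Adj (Sum.inl i) (Sum.inr i) :=
  (SimpleGraph.fromRel_adj _ _ _).2 ⟨by simp, Or.inl (Or.inr ⟨i, rfl, rfl⟩)⟩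

theorem adj_symm_induction {P : ZMod n ⊕ ZMod n → ZMod n ⊕ ZMod n → Prop}
    (hcycle : ∀ i, P (Sum.inl i) (Sum.inl (i + 1)) ∧ P (Sum.inl (i + 1)) (Sum.inl i))
    (hleaf : ∀ i, P (Sum.inl i) (Sum.inr i) ∧ P (Sum.inr i) (Sum.inl i))
    (u v : ZMod n ⊕ ZMod n) (h : (coronaCycleK1 n).Adj u v) : P u v := by
  obtain ⟨-, (⟨i, rfl, rfl⟩ | ⟨i, rfl, rfl⟩) | (⟨i, rfl, rfl⟩ | ⟨i, rfl, rfl⟩)⟩ :=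
    (SimpleGraph.fromRel_adj _ _ _).1 h
  exacts [(hcycle i).1, (hleaf i).1, (hcycle i).2, (hleaf i).2]

theorem eq_of_mem_edgeSet {e : Sym2 (ZMod n ⊕ ZMod n)} (he : e ∈ (coronaCycleK1 n).edgeSet) :
    ∃ i, e = s(Sum.inl i, Sum.inl (i + 1)) ∨ e = s(Sum.inl i, Sum.inr i) := by
  induction e with
  | h u v =>
    refine adj_symm_induction (P := fun u v => ∃ i, s(u, v) = s(Sum.inl i, Sum.inl (i + 1)) ∨
      s(u, v) = s(Sum.inl i, Sum.inr i)) (fun i => ?_) (fun i => ?_) u v he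
    · exact ⟨⟨i, Or.inl rfl⟩, ⟨i, Or.inl Sym2.eq_swap⟩⟩
    · exact ⟨⟨i, Or.inr rfl⟩, ⟨i, Or.inr Sym2.eq_swap⟩⟩

theorem dist_inl (hn : 1 < n) (a : ZMod n) (v : ZMod n ⊕ ZMod n) :
    (coronaCycleK1 n).dist (Sum.inl a) v =
      Sum.elim (cycleDist a) (fun i => cycleDist a i + 1) v := by
  have : NeZero n := ⟨by omega⟩
  apply SimpleGraph.dist_eq_of_descent
  · rintro (i | i)
    · simpa using cycleDist_eq_zero_iff a i
    · simp
  · refine adj_symm_induction (fun i => ?_) (fun i => ?_)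
    · simpa using cycleDist_add_one hn a i
    · simp; omega
  · rintro (i | i) hi
    · rcases exists_cycleDist_descent hn a i hi with h | h
      · exact ⟨Sum.inl (i + 1), (adj_inl_inl_add_one hn i).symm, h⟩
      · exact ⟨Sum.inl (i - 1), by simpa using adj_inl_inl_add_one hn (i - 1), h⟩
    · exact ⟨Sum.inl i, adj_inl_inr i, rfl⟩

theorem dist_inr (hn : 1 < n) (a : ZMod n) (v : ZMod n ⊕ ZMod n) :
    (coronaCycleK1 n).dist (Sum.inr a) v =
      Sum.elim (fun i => cycleDist a i + 1) (fun i => if i = a then 0 else cycleDist a i + 2) v := by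
  have : NeZero n := ⟨by omega⟩
  apply SimpleGraph.dist_eq_of_descent
  · rintro (i | i) <;> simp
  · refine adj_symm_induction (fun i => ?_) (fun i => ?_)
    · simpa using cycleDist_add_one hn a i
    · have := cycleDist_eq_zero_iff a i
      simp only [Sum.elim_inl, Sum.elim_inr]
      split_ifs with h
      · have := this.2 h
        omega
      · omega
  · rintro (i | i) hi
    · by_cases h0 : cycleDist a i = 0
      · obtain rfl := (cycleDist_eq_zero_iff a i).1 h0
        exact ⟨Sum.inr i, (adj_inl_inr i).symm, by simp [h0]⟩
      rcases exists_cycleDist_descent hn a i h0 with h | h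
      · exact ⟨Sum.inl (i + 1), (adj_inl_inl_add_one hn i).symm, by simp [h]⟩
      · exact ⟨Sum.inl (i - 1), by simpa using adj_inl_inl_add_one hn (i - 1), by simp [h]⟩
    · refine ⟨Sum.inl i, adj_inl_inr i, ?_⟩
      have : i ≠ a := by rintro rfl; simp at hi
      simp [this]

theorem exists_dist_eq (hn : 2 < n) (s : ZMod n ⊕ ZMod n) :
    ∃ u v, u ≠ v ∧ (coronaCycleK1 n).dist s u = (coronaCycleK1 n).dist s v := by
  have : NeZero n := ⟨by omega⟩
  have h1n : 1 < n := by omega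
  have key (a : ZMod n) : a + 1 ≠ a - 1 ∧ cycleDist a (a + 1) = cycleDist a (a - 1) := by
    have e0 : ZMod.val (0 : ZMod n) = 0 := ZMod.val_zero
    have e1 := ZMod.val_add_one_eq_ite h1n (0 : ZMod n)
    have e3 := ZMod.val_sub_one_eq_ite h1n (0 : ZMod n)
    rw [if_neg (by omega)] at e1
    rw [if_pos (by omega)] at e3
    have ha : a + 1 - a = 0 + 1 := by ring
    have hb : a - 1 - a = 0 - 1 := by ring
    constructor
    · intro h
      rw [h, hb] at ha
      rw [ha] at e3
      omega
    · unfold cycleDist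
      rw [ha, hb]
      omega
  rcases s with a | a
  all_goals
    obtain ⟨h1, h2⟩ := key a
    refine ⟨Sum.inl (a + 1), Sum.inl (a - 1), by simpa using h1, ?_⟩
  · simp [dist_inl h1n, h2]
  · simp [dist_inr h1n, h2]

theorem edgeDist_inl_cycle (hn : 1 < n) (a i : ZMod n) :
    edgeDist (coronaCycleK1 n) (Sum.inl a) s(Sum.inl i, Sum.inl (i + 1)) =
      min (cycleDist a i) (cycleDist a (i + 1)) := by
  simp [edgeDist, dist_inl hn]

theorem edgeDist_inl_leaf (hn : 1 < n) (a i : ZMod n) :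
    edgeDist (coronaCycleK1 n) (Sum.inl a) s(Sum.inl i, Sum.inr i) = cycleDist a i := by
  simp [edgeDist, dist_inl hn]

theorem edgeDist_leaf_eq_cycle (hn : 1 < n) {a i j : ZMod n} (hi : i ≠ a)
    (h : cycleDist a i = min (cycleDist a j) (cycleDist a (j + 1)))
    (s : ZMod n ⊕ ZMod n) (hs : s = Sum.inl a ∨ s = Sum.inr a) :
    edgeDist (coronaCycleK1 n) s s(Sum.inl i, Sum.inr i) =
      edgeDist (coronaCycleK1 n) s s(Sum.inl j, Sum.inl (j + 1)) := by
  rcases hs with rfl | rfl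
  · rw [edgeDist_inl_cycle hn, edgeDist_inl_leaf hn, h]
  · simp only [edgeDist, Sym2.lift_mk, dist_inr hn, Sum.elim_inl, Sum.elim_inr, if_neg hi]
    omega

theorem leaf_ne_cycle (i j : ZMod n) :
    (s(Sum.inl i, Sum.inr i) : Sym2 (ZMod n ⊕ ZMod n)) ≠ s(Sum.inl j, Sum.inl (j + 1)) := by
  simp

theorem not_isEdgeMG_pair {k : ℕ} (hk : 2 ≤ k) (hn : n = 2 * k + 1) (s t : ZMod n ⊕ ZMod n) :
    ¬ IsEdgeMG (coronaCycleK1 n) {s, t} := by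
  intro h
  have base (x : ZMod n ⊕ ZMod n) : ∃ a, x = Sum.inl a ∨ x = Sum.inr a := by
    rcases x with a | a <;> exact ⟨a, by simp⟩
  obtain ⟨a, ha⟩ := base s
  obtain ⟨b, hb⟩ := base t
  have h1n : 1 < n := by omega
  obtain ⟨i, j, hia, hib, h1, h2⟩ := exists_cycleDist_eq_edge hk hn a b
  obtain ⟨x, hx, hne⟩ := h _ (adj_inl_inr i) _ (adj_inl_inl_add_one h1n j) (leaf_ne_cycle i j)
  rcases hx with rfl | rfl
  · exact hne (edgeDist_leaf_eq_cycle h1n hia h1 _ ha)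
  · exact hne (edgeDist_leaf_eq_cycle h1n hib h2 _ hb)

theorem isVertexMG_pair {k : ℕ} (hk : 1 ≤ k) (hn : n = 2 * k + 1) :
    IsVertexMG (coronaCycleK1 n) {Sum.inl 0, Sum.inl (k : ZMod n)} := by
  have : NeZero n := ⟨by omega⟩
  have h1n : 1 < n := by omega
  have e0 : ZMod.val (0 : ZMod n) = 0 := ZMod.val_zero
  have ek : ZMod.val (k : ZMod n) = k := ZMod.val_cast_of_lt (by omega)
  intro u v huv
  by_contra! hcon
  have h0 := hcon (Sum.inl 0) (by simp)
  have h1 := hcon (Sum.inl (k : ZMod n)) (by simp)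
  apply huv
  rcases u with i | i <;> rcases v with j | j <;>
    simp only [dist_inl h1n, Sum.elim_inl, Sum.elim_inr, cycleDist_eq_val, e0, ek] at h0 h1 <;>
    have hi := i.val_lt <;> have hj := j.val_lt
  · rw [ZMod.val_injective n (show i.val = j.val by omega)]
  · omega
  · omega
  · rw [ZMod.val_injective n (show i.val = j.val by omega)]

theorem isEdgeMG_triple {k : ℕ} (hk : 2 ≤ k) (hn : n = 2 * k + 1) :
    IsEdgeMG (coronaCycleK1 n)
      {Sum.inl 0, Sum.inl (k : ZMod n), Sum.inl ((2 * k : ℕ) : ZMod n)} := by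
  have : NeZero n := ⟨by omega⟩
  have h1n : 1 < n := by omega
  have hk1 : 1 ≤ k := by omega
  intro e he f hf hef
  by_contra! hcon
  have h0 := hcon (Sum.inl 0) (by simp)
  have h1 := hcon (Sum.inl (k : ZMod n)) (by simp)
  have h2 := hcon (Sum.inl ((2 * k : ℕ) : ZMod n)) (by simp)
  apply hef
  obtain ⟨i, rfl | rfl⟩ := eq_of_mem_edgeSet he <;>
    obtain ⟨j, rfl | rfl⟩ := eq_of_mem_edgeSet hf <;>
    simp only [edgeDist_inl_cycle h1n, edgeDist_inl_leaf h1n] at h0 h1 h2 <;>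
    have hi := i.val_lt <;> have hj := j.val_lt
  · have ci := cycleDist_edge_cases hk1 hn i
    have cj := cycleDist_edge_cases hk1 hn j
    rw [h0, h1, h2] at ci
    rw [ZMod.val_injective n (show i.val = j.val by clear h0 h1 h2; omega)]
  · have ci := cycleDist_edge_cases hk1 hn i
    have cj := cycleDist_vertex_cases hn j
    rw [h0, h1, h2] at ci
    clear h0 h1 h2
    omega
  · have ci := cycleDist_vertex_cases hn i
    have cj := cycleDist_edge_cases hk1 hn j
    rw [h0, h1, h2] at ci
    clear h0 h1 h2
    omega
  · have ci := cycleDist_vertex_cases hn i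
    have cj := cycleDist_vertex_cases hn j
    rw [h0, h1, h2] at ci
    rw [ZMod.val_injective n (show i.val = j.val by clear h0 h1 h2; omega)]

theorem metricDim_eq_two {k : ℕ} (hk : 1 ≤ k) (hn : n = 2 * k + 1) :
    metricDim (coronaCycleK1 n) = 2 := by
  have : NeZero n := ⟨by omega⟩
  have ek : ZMod.val (k : ZMod n) = k := ZMod.val_cast_of_lt (by omega)
  have h0k : (0 : ZMod n) ≠ k := by
    intro h
    rw [← h, ZMod.val_zero] at ek
    omega
  have hmem : 2 ∈ {m | ∃ S : Finset (ZMod n ⊕ ZMod n), S.card = m ∧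
      IsVertexMG (coronaCycleK1 n) ↑S} :=
    ⟨{Sum.inl 0, Sum.inl (k : ZMod n)}, Finset.card_pair (by simpa using h0k),
      by simpa using isVertexMG_pair hk hn⟩
  refine le_antisymm (Nat.sInf_le hmem) (le_csInf ⟨2, hmem⟩ ?_)
  rintro m ⟨S, rfl, hS⟩
  by_contra! hlt
  obtain ⟨s, hs⟩ := Finset.card_le_one_iff_subset_singleton.1 (Nat.le_of_lt_succ hlt)
  obtain ⟨u, v, huv, hd⟩ := exists_dist_eq (by omega) s
  obtain ⟨x, hx, hne⟩ := hS u v huv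
  obtain rfl := Finset.mem_singleton.1 (hs hx)
  exact hne hd

theorem edgeMetricDim_eq_three {k : ℕ} (hk : 2 ≤ k) (hn : n = 2 * k + 1) :
    edgeMetricDim (coronaCycleK1 n) = 3 := by
  have : NeZero n := ⟨by omega⟩
  have e0 : ZMod.val (0 : ZMod n) = 0 := ZMod.val_zero
  have ek : ZMod.val (k : ZMod n) = k := ZMod.val_cast_of_lt (by omega)
  have el : ZMod.val ((2 * k : ℕ) : ZMod n) = 2 * k := ZMod.val_cast_of_lt (by omega)
  have inl_ne {x y : ZMod n} (h : x.val ≠ y.val) :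
      (Sum.inl x : ZMod n ⊕ ZMod n) ≠ Sum.inl y := fun hxy => h (by rw [Sum.inl.inj hxy])
  have hmem : 3 ∈ {m | ∃ S : Finset (ZMod n ⊕ ZMod n), S.card = m ∧
      IsEdgeMG (coronaCycleK1 n) ↑S} :=
    ⟨{Sum.inl 0, Sum.inl (k : ZMod n), Sum.inl ((2 * k : ℕ) : ZMod n)},
      Finset.card_eq_three.2 ⟨_, _, _, inl_ne (by omega), inl_ne (by omega), inl_ne (by omega), rfl⟩,
      by simpa only [Finset.coe_insert, Finset.coe_singleton] using isEdgeMG_triple hk hn⟩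
  refine le_antisymm (Nat.sInf_le hmem) (le_csInf ⟨3, hmem⟩ ?_)
  rintro m ⟨S, rfl, hS⟩
  by_contra! hlt
  obtain ⟨T, hST, hT⟩ := Finset.exists_superset_card_eq (s := S) (n := 2) (by omega) (by
    rw [Fintype.card_sum, ZMod.card]
    omega)
  obtain ⟨s, t, -, rfl⟩ := Finset.card_eq_two.1 hT
  refine not_isEdgeMG_pair hk hn s t fun e he f hf hef => ?_
  obtain ⟨x, hx, hne⟩ := hS e he f hf hef
  exact ⟨x, by simpa using hST hx, hne⟩

end coronaCycleK1

theorem statement_18 (n : ℕ) (hn : 7 ≤ n) (hpar : Odd n) :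
    metricDim (coronaCycleK1 n) = 2 ∧ edgeMetricDim (coronaCycleK1 n) = 3 ∧
    (metricDim (coronaCycleK1 n) : ℤ) - edgeMetricDim (coronaCycleK1 n) = -1 := by
  obtain ⟨k, hk⟩ := hpar
  have h2 := coronaCycleK1.metricDim_eq_two (k := k) (by omega) hk
  have h3 := coronaCycleK1.edgeMetricDim_eq_three (k := k) (by omega) hk
  exact ⟨h2, h3, by rw [h2, h3]; norm_num⟩
end
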